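/- arXiv:2208.11573 — 3 statements merged into one kernel-verified Lean document; each statement's English description precedes it below -/
import Mathlib

section
/- For every (n,m)-system, the inequality n ≤ C(m+2,2) + 6·m^{5/3} + 3·m^{4/3} + 9·m − 3 holds (as an inequality of real numbers, where C(m+2,2) denotes the binomial coefficient and m^{5/3}, m^{4/3} are real powers). -/
open Finset

/-- An `(n,m)`-system: a collection `N 1, …, N ℓ` of distinct `k`-element subsets of a
finite vertex set `V` of cardinality `n`, covering `V`, with `ℓ ≥ 2`, `k ≥ 3`,
satisfying the minimal-empty-intersection property (i) and the clique property (ii). -/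
structure NMSystem (α : Type*) [DecidableEq α] where
  ell : ℕ
  k : ℕ
  V : Finset α
  N : Fin ell → Finset α
  h_ell : 2 ≤ ell
  h_k : 3 ≤ k
  h_inj : Function.Injective N
  h_card : ∀ i, (N i).card = k
  h_sub : ∀ i, N i ⊆ V
  h_cover : ∀ v ∈ V, ∃ i, v ∈ N i
  h_empty_inter : ∀ v : α, ¬ (∀ i, v ∈ N i)
  h_min : ∀ i, ∃ v, ∀ j, j ≠ i → v ∈ N j
  h_clique : ∀ S ⊆ V, k + 1 ≤ S.card → ∃ T ⊆ S, T.card = 3 ∧ ∀ i, ¬ T ⊆ N i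

namespace NMSystem

variable {α : Type*} [DecidableEq α]

/-- the number of vertices `n` -/
def n (S : NMSystem α) : ℕ := S.V.card

/-- the parameter `m = n - k` -/
def m (S : NMSystem α) : ℕ := S.n - S.k

end NMSystem

section Graph
variable {α : Type*} [DecidableEq α]

/-- A maximal subgraph of maximum degree at most two has at least as many edges as the vertex
cover number. -/
theorem exists_degree_le_two_subgraph_and_cover (G : Finset (Finset α))
    (hG : ∀ e ∈ G, e.card = 2) :
    ∃ F ⊆ G, (∀ v, (F.filter (v ∈ ·)).card ≤ 2) ∧
      ∃ U : Finset α, U.card ≤ F.card ∧ ∀ e ∈ G, ¬ Disjoint e U := by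
  classical
  obtain ⟨F, hFm⟩ := (G.powerset.filter
    (fun F => ∀ v, (F.filter (v ∈ ·)).card ≤ 2)).exists_maximal ⟨∅, by simp⟩
  have hF := hFm.prop
  simp only [mem_filter, mem_powerset] at hF
  refine ⟨F, hF.1, hF.2, ?_⟩
  set S : Finset α := (F.biUnion id).filter (fun v => (F.filter (v ∈ ·)).card = 2)
  have hne : ∀ e ∈ F, e.Nonempty := fun e he =>
    card_pos.1 (by rw [hG e (hF.1 he)]; norm_num)
  let pick : Finset α → Finset α := fun e => if h : e.Nonempty then {h.choose} else ∅
  have hpick : ∀ e ∈ F, ¬ Disjoint e (pick e) := by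
    intro e he
    simp only [pick, dif_pos (hne e he), disjoint_singleton_right, not_not]
    exact (hne e he).choose_spec
  have hpick1 : ∀ e, (pick e).card ≤ 1 := by
    intro e
    by_cases h : e.Nonempty <;> simp [pick, h]
  have hScard : S.card ≤ (F.filter (fun e => ¬ Disjoint e S)).card := by
    have h1 := Finset.sum_card_bipartiteAbove_eq_sum_card_bipartiteBelow
      (s := S) (t := F) (fun v e => v ∈ e)
    have h2 : ∑ v ∈ S, (F.bipartiteAbove (fun v e => v ∈ e) v).card = S.card * 2 := by
      rw [← smul_eq_mul, ← sum_const]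
      exact sum_congr rfl fun v hv => (mem_filter.1 hv).2
    have h3 : ∑ e ∈ F, (S.bipartiteBelow (fun v e => v ∈ e) e).card
        ≤ (F.filter (fun e => ¬ Disjoint e S)).card * 2 := by
      rw [← smul_eq_mul, ← sum_const, sum_filter]
      refine sum_le_sum fun e he => ?_
      split_ifs with hd
      swap
      · rw [← hG e (hF.1 he)]
        exact card_le_card fun v hv => (mem_filter.1 hv).2
      · rw [Nat.le_zero, card_eq_zero, eq_empty_iff_forall_notMem]
        intro v hv
        exact disjoint_left.1 hd (mem_filter.1 hv).2 (mem_filter.1 hv).1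
    omega
  refine ⟨S ∪ (F.filter (fun e => Disjoint e S)).biUnion pick, ?_, ?_⟩
  · have h4 : ((F.filter (fun e => Disjoint e S)).biUnion pick).card
        ≤ (F.filter (fun e => Disjoint e S)).card := by
      simpa using card_biUnion_le_card_mul _ _ 1 (fun e _ => hpick1 e)
    have h5 := card_union_le S ((F.filter (fun e => Disjoint e S)).biUnion pick)
    have h6 := card_filter_add_card_filter_not (s := F) (fun e => Disjoint e S)
    omega
  · intro e he hd
    rw [disjoint_union_right] at hd
    by_cases heF : e ∈ F
    · refine hpick e heF (hd.2.mono_right ?_)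
      exact subset_biUnion_of_mem pick (mem_filter.2 ⟨heF, hd.1⟩)
    · have hins : ¬ ∀ v, ((insert e F).filter (v ∈ ·)).card ≤ 2 := by
        intro hall
        have := hFm.le_of_ge (y := insert e F)
          (by simp only [mem_filter, mem_powerset]; exact ⟨insert_subset he hF.1, hall⟩)
          (subset_insert e F)
        exact heF (this (mem_insert_self e F))
      push Not at hins
      obtain ⟨v, hv⟩ := hins
      have hFv := hF.2 v
      rw [filter_insert] at hv
      split_ifs at hv with hve
      · have := card_insert_le e (F.filter (v ∈ ·))
        have h2 : (F.filter (v ∈ ·)).card = 2 := by omega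
        refine disjoint_left.1 hd.1 hve (mem_filter.2 ⟨?_, h2⟩)
        obtain ⟨f, hf⟩ : (F.filter (v ∈ ·)).Nonempty := card_pos.1 (by omega)
        exact mem_biUnion.2 ⟨f, (mem_filter.1 hf).1, (mem_filter.1 hf).2⟩
      · omega

/-- In a graph of maximum degree two, the edges adjacent to a given edge can be met by two vertices
outside that edge. -/
theorem exists_card_le_two_meeting_adjacent (F : Finset (Finset α)) (hF : ∀ e ∈ F, e.card = 2)
    (hdeg : ∀ v, (F.filter (v ∈ ·)).card ≤ 2) {A : Finset α} (hA : A ∈ F) :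
    ∃ E : Finset α, E.card ≤ 2 ∧ Disjoint A E ∧
      ∀ e ∈ F, e ≠ A → ¬ Disjoint e A → ¬ Disjoint e E := by
  classical
  have hex : ∀ e ∈ F, e ≠ A → (e \ A).Nonempty := by
    intro e he hne
    rw [sdiff_nonempty]
    intro hsub
    exact hne (eq_of_subset_of_card_le hsub (by rw [hF e he, hF A hA]))
  let pick : Finset α → Finset α := fun e => if h : (e \ A).Nonempty then {h.choose} else ∅
  have hpick1 : ∀ e, (pick e).card ≤ 1 := by
    intro e
    by_cases h : (e \ A).Nonempty <;> simp [pick, h]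
  have hpick : ∀ e, pick e ⊆ e \ A := by
    intro e
    by_cases h : (e \ A).Nonempty
    · simpa [pick, h] using mem_sdiff.1 h.choose_spec
    · simp [pick, h]
  have hcard : ∀ v ∈ A, ((F.filter (v ∈ ·)).erase A).card ≤ 1 := by
    intro v hv
    rw [card_erase_of_mem (mem_filter.2 ⟨hA, hv⟩)]
    have := hdeg v
    omega
  refine ⟨(A.biUnion fun v => (F.filter (v ∈ ·)).erase A).biUnion pick, ?_, ?_, ?_⟩
  · have h1 := card_biUnion_le_card_mul A (fun v => (F.filter (v ∈ ·)).erase A) 1 hcard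
    have h2 := card_biUnion_le_card_mul (A.biUnion fun v => (F.filter (v ∈ ·)).erase A) pick 1
      (fun e _ => hpick1 e)
    rw [hF A hA] at h1
    omega
  · rw [disjoint_biUnion_right]
    exact fun e _ => disjoint_sdiff.mono_right (hpick e)
  · intro e he hne hadj hd
    obtain ⟨v, hve, hvA⟩ := not_disjoint_iff.1 hadj
    have hmem : e ∈ A.biUnion fun v => (F.filter (v ∈ ·)).erase A :=
      mem_biUnion.2 ⟨v, hvA, mem_erase.2 ⟨hne, mem_filter.2 ⟨he, hve⟩⟩⟩
    have hd' := hd.mono_right (subset_biUnion_of_mem pick hmem)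
    have h := hex e he hne
    have hc := h.choose_spec
    simp only [pick, dif_pos h, disjoint_singleton_right] at hd'
    exact hd' (mem_sdiff.1 hc).1

end Graph

section Algebra
variable {α : Type*}

/-- Pairs of exponents of total degree at most `D`. -/
def degreePairs (D : ℕ) : Finset (ℕ × ℕ) := (range (D + 1)).biUnion antidiagonal

theorem mem_degreePairs {D : ℕ} {p : ℕ × ℕ} : p ∈ degreePairs D ↔ p.1 + p.2 ≤ D := by
  simp [degreePairs]

theorem card_degreePairs (D : ℕ) : (degreePairs D).card = (D + 2).choose 2 := by
  rw [degreePairs, card_biUnion]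
  · simp only [Nat.card_antidiagonal]
    induction D with
    | zero => simp
    | succ D ih =>
      rw [sum_range_succ, ih, Nat.choose_succ_succ' (D + 2) 1, Nat.choose_one_right,
        one_add_one_eq_two]
      omega
  · intro i _ j _ hij
    refine disjoint_left.2 fun p hp hq => hij ?_
    rw [HasAntidiagonal.mem_antidiagonal] at hp hq
    omega

/-- The sum of the indeterminates attached to the elements of a finset. -/
noncomputable def labelSum (A : Finset α) : MvPolynomial α ℚ := ∑ a ∈ A, MvPolynomial.X a

/-- The product of the indeterminates attached to the elements of a finset. -/
noncomputable def labelProd (A : Finset α) : MvPolynomial α ℚ := ∏ a ∈ A, MvPolynomial.X a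

variable (α) in
/-- Functions on finsets given by polynomials of total degree at most `D` in the sum and the
product of the labels. -/
noncomputable def symmFunctions (D : ℕ) :
    Submodule (MvPolynomial α ℚ) (Finset α → MvPolynomial α ℚ) :=
  Submodule.span _ ((fun p : ℕ × ℕ => labelSum ^ p.1 * labelProd ^ p.2) '' degreePairs D)

theorem symmFunctions_mul_le (D D' : ℕ) :
    symmFunctions α D * symmFunctions α D' ≤ symmFunctions α (D + D') := by
  rw [symmFunctions, symmFunctions, Submodule.span_mul_span]
  refine Submodule.span_mono ?_
  rintro _ ⟨_, ⟨p, hp, rfl⟩, _, ⟨q, hq, rfl⟩, rfl⟩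
  refine ⟨p + q, ?_, ?_⟩
  · simp only [mem_coe, mem_degreePairs, Prod.fst_add, Prod.snd_add] at hp hq ⊢
    omega
  · simp only [Prod.fst_add, Prod.snd_add]
    ring

theorem symmFunctions_mono {D D' : ℕ} (h : D ≤ D') : symmFunctions α D ≤ symmFunctions α D' := by
  refine Submodule.span_mono (Set.image_mono fun p hp => ?_)
  simp only [mem_coe, mem_degreePairs] at hp ⊢
  omega

variable [DecidableEq α]

/-- A product of linear factors vanishing exactly on the pairs that meet `B`. -/
theorem exists_mem_symmFunctions_eq_zero_iff (B : Finset α) :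
    ∃ f ∈ symmFunctions α B.card, ∀ A : Finset α, A.card = 2 → (f A = 0 ↔ ¬ Disjoint A B) := by
  induction B using Finset.induction_on with
  | empty =>
    refine ⟨1, Submodule.subset_span ⟨(0, 0), ?_, by simp⟩, by simp⟩
    simp [mem_degreePairs]
  | insert b B hb ih =>
    obtain ⟨f, hf, hfA⟩ := ih
    let g : Finset α → MvPolynomial α ℚ := fun A =>
      MvPolynomial.X b ^ 2 - MvPolynomial.X b * labelSum A + labelProd A
    have hg : g ∈ symmFunctions α 1 := by
      have h0 : (1 : Finset α → MvPolynomial α ℚ) ∈ symmFunctions α 1 :=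
        Submodule.subset_span ⟨(0, 0), by simp [mem_degreePairs], by simp⟩
      have h1 : labelSum ∈ symmFunctions α 1 :=
        Submodule.subset_span ⟨(1, 0), by simp [mem_degreePairs], by simp⟩
      have h2 : labelProd ∈ symmFunctions α 1 :=
        Submodule.subset_span ⟨(0, 1), by simp [mem_degreePairs], by simp⟩
      have : g = (MvPolynomial.X b ^ 2 : MvPolynomial α ℚ) • (1 : Finset α → MvPolynomial α ℚ)
          - (MvPolynomial.X b : MvPolynomial α ℚ) • labelSum + labelProd := by
        ext1 A
        simp [g]
      rw [this]
      exact add_mem (sub_mem (Submodule.smul_mem _ _ h0) (Submodule.smul_mem _ _ h1)) h2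
    refine ⟨f * g, ?_, ?_⟩
    · rw [card_insert_of_notMem hb]
      exact symmFunctions_mul_le _ _ (Submodule.mul_mem_mul hf hg)
    · intro A hA
      rw [Pi.mul_apply, mul_eq_zero, hfA A hA, disjoint_insert_right, not_and_or, not_not, or_comm]
      refine or_congr ?_ Iff.rfl
      obtain ⟨s, t, hst, rfl⟩ := card_eq_two.1 hA
      have : g {s, t} = (MvPolynomial.X b - MvPolynomial.X s)
          * (MvPolynomial.X b - MvPolynomial.X t) := by
        simp only [g, labelSum, labelProd, sum_pair hst, prod_pair hst]
        ring
      rw [this, mul_eq_zero, sub_eq_zero, sub_eq_zero, MvPolynomial.X_inj, MvPolynomial.X_inj]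
      simp

/-- The labels of a pair are generic over the labels of any family of pairs disjoint from it. -/
theorem exists_mem_symmFunctions_separating {d : ℕ} {A : Finset α} (hA : A.card = 2)
    (Z : Finset (Finset α)) (hZ : ∀ B ∈ Z, Disjoint B A) (hcard : Z.card < (d + 2).choose 2) :
    ∃ f ∈ symmFunctions α d, f A ≠ 0 ∧ ∀ B ∈ Z, f B = 0 := by
  classical
  let R := MvPolynomial {v // v ∉ A} ℚ
  let ι : R →ₐ[ℚ] MvPolynomial α ℚ := MvPolynomial.rename Subtype.val
  let y : α → R := fun v => if h : v ∉ A then MvPolynomial.X ⟨v, h⟩ else 0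
  have hy : ∀ v, v ∉ A → ι (y v) = MvPolynomial.X v := by
    intro v hv
    simp only [y, dif_pos hv, ι]
    exact MvPolynomial.rename_X _ _
  let ev : ℕ × ℕ → Finset α → R := fun p B => (∑ v ∈ B, y v) ^ p.1 * (∏ v ∈ B, y v) ^ p.2
  have hev : ∀ p, ∀ B ∈ Z, ι (ev p B) = labelSum B ^ p.1 * labelProd B ^ p.2 := by
    intro p B hB
    have h : ∀ v ∈ B, ι (y v) = MvPolynomial.X v :=
      fun v hv => hy v (disjoint_left.1 (hZ B hB) hv)
    simp only [ev, map_mul, map_pow, map_sum, map_prod, labelSum, labelProd]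
    rw [sum_congr rfl h, prod_congr rfl h]
  obtain ⟨c, hc0, hc⟩ : ∃ c : degreePairs d → R, c ≠ 0 ∧ ∀ B ∈ Z, ∑ p, c p * ev p B = 0 := by
    let L : (degreePairs d → R) →ₗ[R] (Z → R) :=
      LinearMap.pi fun B => ∑ p : degreePairs d, (LinearMap.proj p).smulRight (ev p B)
    have hL : ¬ Function.Injective L := fun hinj => by
      have := card_le_of_injective R L hinj
      simp only [Fintype.card_coe, card_degreePairs] at this
      omega
    rw [← LinearMap.ker_eq_bot, Submodule.eq_bot_iff] at hL
    push Not at hL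
    obtain ⟨c, hc, hc0⟩ := hL
    refine ⟨c, hc0, fun B hB => ?_⟩
    simpa [L] using congrFun (LinearMap.mem_ker.1 hc) ⟨B, hB⟩
  refine ⟨∑ p, ι (c p) • (labelSum ^ p.1.1 * labelProd ^ p.1.2),
    sum_mem fun p _ => Submodule.smul_mem _ _ (Submodule.subset_span ⟨p, p.2, rfl⟩), ?_, ?_⟩
  · obtain ⟨a, b, hab, rfl⟩ := card_eq_two.1 hA
    intro h0
    let S : Polynomial (Polynomial R) := Polynomial.C Polynomial.X
    let ψ : MvPolynomial α ℚ →ₐ[ℚ] Polynomial (Polynomial R) := MvPolynomial.aeval fun v =>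
      if v = a then Polynomial.X else if v = b then S - Polynomial.X
      else Polynomial.C (Polynomial.C (y v))
    have hψ : ∀ r : R, ψ (ι r) = Polynomial.C (Polynomial.C r) := by
      intro r
      have : ψ.comp ι = (Polynomial.CAlgHom (R := ℚ) (A := Polynomial R)).comp
          (Polynomial.CAlgHom (R := ℚ) (A := R)) := by
        refine MvPolynomial.algHom_ext fun v => ?_
        have hv := v.2
        simp only [mem_insert, mem_singleton, not_or] at hv
        simp [ψ, ι, hv.1, hv.2, y]
      exact DFunLike.congr_fun this r
    have ha : ψ (MvPolynomial.X a) = Polynomial.X := by simp [ψ]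
    have hb : ψ (MvPolynomial.X b) = S - Polynomial.X := by simp [ψ, hab.symm]
    let q : Polynomial (Polynomial R) := Polynomial.X * (S - Polynomial.X)
    let h : Polynomial (Polynomial R) :=
      ∑ p, Polynomial.monomial p.1.2 (Polynomial.monomial p.1.1 (c p))
    have hh : h.comp q = 0 := by
      rw [← map_zero ψ, ← h0]
      simp only [h, Finset.sum_apply, Pi.smul_apply, Pi.mul_apply, Pi.pow_apply, labelSum,
        labelProd, sum_pair hab, prod_pair hab, map_sum, smul_eq_mul, map_mul, map_pow, map_add,
        hψ, ha, hb, Polynomial.sum_comp, Polynomial.monomial_comp,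
        q, S]
      refine sum_congr rfl fun p _ => ?_
      rw [← Polynomial.C_mul_X_pow_eq_monomial]
      simp only [map_mul, map_pow]
      ring
    rw [Polynomial.comp_eq_zero_iff] at hh
    rcases hh with hh | ⟨-, hq⟩
    · refine hc0 (funext fun p => ?_)
      have := congrArg (fun f => (Polynomial.coeff (Polynomial.coeff f p.1.2) p.1.1)) hh
      simp only [h, Polynomial.finsetSum_coeff, Polynomial.coeff_monomial, Polynomial.coeff_zero]
        at this
      rw [sum_eq_single p] at this
      · simpa using this
      · intro p' _ hne
        split_ifs with h1
        · rw [Polynomial.coeff_monomial, if_neg]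
          intro h2
          exact hne (Subtype.ext (Prod.ext h2 h1))
        · simp
      · simp
    · have := congrArg (fun f => Polynomial.coeff f 2) hq
      rw [show (2 : ℕ) = 1 + 1 from rfl, Polynomial.coeff_X_mul] at this
      simp [S] at this
  · intro B hB
    rw [← map_zero ι, ← hc B hB]
    simp only [Finset.sum_apply, Pi.smul_apply, Pi.mul_apply, Pi.pow_apply, smul_eq_mul, map_sum,
      map_mul]
    exact sum_congr rfl fun p _ => by rw [hev p B hB]

/-- A skew set-pair inequality for pairs, in which a bounded number of disjoint exceptional pairs
may be missed by each blocking set. -/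
theorem card_le_choose_of_skew_set_pairs {J : Type*} [Fintype J] {M d : ℕ} (rk : J → ℕ)
    (A B : J → Finset α) (Z : J → Finset (Finset α)) (hA : ∀ j, (A j).card = 2)
    (hB : ∀ j, (B j).card ≤ M) (hAB : ∀ j, Disjoint (A j) (B j))
    (hZ : ∀ j, ∀ C ∈ Z j, Disjoint C (A j)) (hZcard : ∀ j, (Z j).card < (d + 2).choose 2)
    (hskew : ∀ j j', j' ≠ j → rk j' ≤ rk j → ¬ Disjoint (A j') (B j) ∨ A j' ∈ Z j) :
    Fintype.card J ≤ (M + d + 2).choose 2 := by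
  classical
  choose f hf hfA using fun j => exists_mem_symmFunctions_eq_zero_iff (B j)
  choose g hg hgA hgZ using fun j =>
    exists_mem_symmFunctions_separating (hA j) (Z j) (hZ j) (hZcard j)
  have hmem : ∀ j, f j * g j ∈ symmFunctions α (M + d) := fun j =>
    symmFunctions_mono (Nat.add_le_add_right (hB j) d)
      (symmFunctions_mul_le _ _ (Submodule.mul_mem_mul (hf j) (hg j)))
  have hli : LinearIndependent (MvPolynomial α ℚ) (fun j => f j * g j) := by
    rw [Fintype.linearIndependent_iff]
    intro c hc
    by_contra! hne
    have hne' : (univ.filter fun j => c j ≠ 0).Nonempty := by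
      obtain ⟨i, hi⟩ := hne
      exact ⟨i, by simpa using hi⟩
    obtain ⟨j, hj, hmin⟩ := exists_min_image _ rk hne'
    have hcj : c j ≠ 0 := (mem_filter.1 hj).2
    have h := congrFun hc (A j)
    rw [Finset.sum_apply, sum_eq_single j] at h
    · simp only [Pi.smul_apply, Pi.mul_apply, Pi.zero_apply, smul_eq_mul, mul_eq_zero, hcj,
        false_or, hfA j _ (hA j), hgA j, or_false] at h
      exact h (hAB j)
    · intro i _ hij
      by_cases hci : c i = 0
      · simp [hci]
      · have : f i (A j) * g i (A j) = 0 := by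
          rcases hskew i j hij.symm (hmin i (by simpa using hci)) with h1 | h1
          · rw [(hfA i _ (hA j)).2 h1, zero_mul]
          · rw [hgZ i _ h1, mul_zero]
        simp [this]
    · simp
  have h := linearIndependent_le_span' _ hli
    ((degreePairs (M + d)).image fun p : ℕ × ℕ => (labelSum (α := α)) ^ p.1 * labelProd ^ p.2 :
      Finset (Finset α → MvPolynomial α ℚ)) (by
      rintro _ ⟨j, rfl⟩
      rw [coe_image]
      exact hmem j)
  rw [Cardinal.mk_fintype, Nat.cast_le] at h
  refine h.trans ?_
  simp only [coe_sort_coe, Fintype.card_coe]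
  rw [← card_degreePairs]
  exact card_image_le

end Algebra

namespace NMSystem

variable {α : Type*} [DecidableEq α]

theorem m_add_k (S : NMSystem α) : S.m + S.k = S.n := by
  have i : Fin S.ell := ⟨0, by have := S.h_ell; omega⟩
  have h := card_le_card (S.h_sub i)
  rw [S.h_card i] at h
  simp only [m, n] at h ⊢
  omega

/-- The complement of a clique of the system. -/
def transversal (S : NMSystem α) (i : Fin S.ell) : Finset α := S.V \ S.N i

theorem card_transversal (S : NMSystem α) (i : Fin S.ell) : (S.transversal i).card = S.m := by
  rw [transversal, card_sdiff_of_subset (S.h_sub i), S.h_card i]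
  rfl

theorem m_pos (S : NMSystem α) : 1 ≤ S.m := by
  by_contra! h
  have h0 : ∀ i, S.N i = S.V := fun i =>
    eq_of_subset_of_card_le (S.h_sub i) (by
      have h1 := S.m_add_k
      have h2 := S.h_card i
      simp only [n] at h1
      omega)
  have h2 := S.h_ell
  have := S.h_inj ((h0 ⟨0, by omega⟩).trans (h0 ⟨1, by omega⟩).symm)
  simp at this

/-- The elements whose last occurrence in the sequence of complements is at index `i`. -/
def lastPart (S : NMSystem α) (i : Fin S.ell) : Finset α :=
  (S.transversal i).filter fun v => ∀ j, i < j → v ∉ S.transversal j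

theorem n_le_sum_card_lastPart (S : NMSystem α) : S.n ≤ ∑ i, (S.lastPart i).card := by
  refine (card_le_card fun v hv => ?_).trans card_biUnion_le
  have hne : (univ.filter fun i => v ∈ S.transversal i).Nonempty := by
    have h := S.h_empty_inter v
    push Not at h
    obtain ⟨i, hi⟩ := h
    exact ⟨i, by simp [transversal, hv, hi]⟩
  obtain ⟨i, hi, hmax⟩ := exists_max_image _ id hne
  refine mem_biUnion.2 ⟨i, mem_univ _, mem_filter.2 ⟨(mem_filter.1 hi).2, fun j hj hvj => ?_⟩⟩
  exact absurd (hmax j (by simpa using hvj)) (not_le.2 hj)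

/-- A set meeting every triple that lies in no clique has at least `m` elements. -/
theorem m_le_card_of_meets (S : NMSystem α) (R : Finset α)
    (hR : ∀ e ⊆ S.V, e.card = 3 → (∀ i, ¬ e ⊆ S.N i) → ¬ Disjoint e R) : S.m ≤ R.card := by
  by_contra! h
  obtain ⟨e, he, he3, heN⟩ := S.h_clique (S.V \ R) sdiff_subset (by
    have h1 := S.m_add_k
    have h2 := le_card_sdiff R S.V
    simp only [n] at h1
    omega)
  exact hR e (he.trans sdiff_subset) he3 heN (disjoint_sdiff.symm.mono_left he)

/-- The pairs in a clique completed by some element of `lastPart i` to a triple that lies in no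
clique. -/
def link (S : NMSystem α) (i : Fin S.ell) : Finset (Finset α) :=
  ((S.N i).powersetCard 2).filter fun e => ∃ x ∈ S.lastPart i, ∀ j, ¬ insert x e ⊆ S.N j

/-- The elements of a clique completed by two elements of `lastPart i` to a triple that lies in no
clique. -/
def apex (S : NMSystem α) (i : Fin S.ell) : Finset α :=
  (S.N i).filter fun c => ∃ x ∈ S.lastPart i, ∃ y ∈ S.lastPart i, ∀ j, ¬ {x, y, c} ⊆ S.N j

theorem disjoint_transversal_of_mem_link (S : NMSystem α) {i : Fin S.ell} {e : Finset α}
    (he : e ∈ S.link i) : Disjoint e (S.transversal i) :=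
  disjoint_sdiff.mono_left (mem_powersetCard.1 (mem_filter.1 he).1).1

theorem mem_N_of_mem_lastPart (S : NMSystem α) {i j : Fin S.ell} (hij : i < j) {x : α}
    (hx : x ∈ S.lastPart i) : x ∈ S.N j := by
  obtain ⟨h1, h2⟩ := mem_filter.1 hx
  have h3 := h2 j hij
  simp only [transversal, mem_sdiff, not_and, not_not] at h1 h3
  exact h3 h1.1

theorem not_disjoint_transversal_of_mem_link (S : NMSystem α) {i j : Fin S.ell} (hij : i < j)
    {e : Finset α} (he : e ∈ S.link i) : ¬ Disjoint e (S.transversal j) := by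
  obtain ⟨h1, x, hx, hxe⟩ := mem_filter.1 he
  intro hd
  refine hxe j (insert_subset (S.mem_N_of_mem_lastPart hij hx) fun v hv => ?_)
  have h2 := disjoint_left.1 hd hv
  simp only [transversal, mem_sdiff, not_and, not_not] at h2
  exact h2 (S.h_sub i ((mem_powersetCard.1 h1).1 hv))

theorem apex_subset_transversal (S : NMSystem α) {i j : Fin S.ell} (hij : i < j) :
    S.apex i ⊆ S.transversal j := by
  intro c hc
  obtain ⟨h1, x, hx, y, hy, hxy⟩ := mem_filter.1 hc
  refine mem_sdiff.2 ⟨S.h_sub i h1, fun hcj => hxy j ?_⟩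
  simp [insert_subset_iff, S.mem_N_of_mem_lastPart hij hx, S.mem_N_of_mem_lastPart hij hy, hcj]

theorem card_lastPart_le_of_cover (S : NMSystem α) {i j : Fin S.ell} (hij : i < j) {U : Finset α}
    (hU : ∀ e ∈ S.link i, ¬ Disjoint e U) : (S.lastPart i).card ≤ U.card + (S.apex i).card := by
  have hXT : S.lastPart i ⊆ S.transversal i := filter_subset _ _
  have key := S.m_le_card_of_meets ((S.transversal i \ S.lastPart i) ∪ (U ∪ S.apex i)) ?_
  · have h1 := card_union_le (S.transversal i \ S.lastPart i) (U ∪ S.apex i)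
    have h2 := card_union_le U (S.apex i)
    have h3 := card_sdiff_add_card_eq_card hXT
    have h4 := S.card_transversal i
    omega
  intro e heV he3 heN hd
  simp only [disjoint_union_right] at hd
  obtain ⟨hd1, hdU, hdC⟩ := hd
  have hN : ∀ v ∈ e, v ∉ S.lastPart i → v ∈ S.N i := by
    intro v hv hvX
    by_contra hvN
    exact disjoint_left.1 hd1 hv (mem_sdiff.2 ⟨mem_sdiff.2 ⟨heV hv, hvN⟩, hvX⟩)
  obtain ⟨x, hxe, hx⟩ : ∃ x ∈ e, x ∈ S.lastPart i := by
    by_contra! h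
    exact heN i fun v hv => hN v hv (h v hv)
  obtain ⟨c, hce, hc⟩ : ∃ c ∈ e, c ∉ S.lastPart i := by
    by_contra! h
    exact heN j fun v hv => S.mem_N_of_mem_lastPart hij (h v hv)
  have hxc : x ≠ c := by
    rintro rfl
    exact hc hx
  have hcard : ((e.erase x).erase c).card = 1 := by
    rw [card_erase_of_mem (mem_erase.2 ⟨hxc.symm, hce⟩), card_erase_of_mem hxe, he3]
  obtain ⟨y, hy⟩ := card_eq_one.1 hcard
  have he : e = {x, y, c} := by
    rw [← insert_erase hxe, ← insert_erase (mem_erase.2 ⟨hxc.symm, hce⟩), hy, pair_comm]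
  have hye : y ∈ e := by simp [he]
  by_cases hyX : y ∈ S.lastPart i
  · exact disjoint_left.1 hdC hce
      (mem_filter.2 ⟨hN c hce hc, x, hx, y, hyX, fun j' => he ▸ heN j'⟩)
  · refine hU (e.erase x) (mem_filter.2 ⟨mem_powersetCard.2 ⟨fun v hv => ?_, ?_⟩, x, hx, ?_⟩)
      (hdU.mono_left (erase_subset _ _))
    · rw [he, mem_erase] at hv
      simp only [mem_insert, mem_singleton] at hv
      rcases hv with ⟨hvx, rfl | rfl | rfl⟩
      · exact absurd rfl hvx
      · exact hN _ hye hyX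
      · exact hN _ hce hc
    · rw [card_erase_of_mem hxe, he3]
    · rwa [insert_erase hxe]

theorem exists_subgraph_of_link (S : NMSystem α) {i j : Fin S.ell} (hij : i < j) :
    ∃ F ⊆ S.link i, (∀ v, (F.filter (v ∈ ·)).card ≤ 2) ∧ F.card ≤ S.m ∧
      (S.lastPart i).card ≤ F.card + (S.apex i).card := by
  obtain ⟨F, hF, hdeg, U, hUF, hU⟩ := exists_degree_le_two_subgraph_and_cover (S.link i)
    (fun e he => (mem_powersetCard.1 (mem_filter.1 he).1).2)
  have hX := S.card_lastPart_le_of_cover hij hU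
  by_cases hm : F.card ≤ S.m
  · exact ⟨F, hF, hdeg, hm, by omega⟩
  · obtain ⟨F', hF', hcard⟩ := exists_subset_card_eq (not_le.1 hm).le
    refine ⟨F', hF'.trans hF, fun v => ?_, hcard.le, ?_⟩
    · exact (card_le_card (filter_subset_filter _ hF')).trans (hdeg v)
    · have h1 : (S.lastPart i).card ≤ (S.transversal i).card := card_le_card (filter_subset _ _)
      rw [S.card_transversal i] at h1
      omega

theorem sum_card_apex_le (S : NMSystem α) {t : Fin S.ell} (ht : ∀ i, i ≤ t) :
    ∑ i ∈ univ.erase t, (S.apex i).card ≤ S.m := by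
  have hlt : ∀ i, i ≠ t → i < t := fun i hi => lt_of_le_of_ne (ht i) hi
  have hdis : ∀ i j, i < j → Disjoint (S.apex i) (S.apex j) := fun i j hij =>
    disjoint_sdiff.symm.mono (S.apex_subset_transversal hij) (filter_subset _ _)
  rw [← card_biUnion, ← S.card_transversal t]
  · refine card_le_card (biUnion_subset.2 fun i hi => ?_)
    exact S.apex_subset_transversal (hlt i (ne_of_mem_erase hi))
  · intro i _ j _ hij
    rcases lt_or_gt_of_ne hij with h | h
    · exact hdis i j h
    · exact (hdis j i h).symm

theorem sum_card_le_choose (S : NMSystem α) {d : ℕ} (hd : S.m ≤ (d + 2).choose 2)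
    (F : Fin S.ell → Finset (Finset α)) (hF : ∀ i, F i ⊆ S.link i)
    (hdeg : ∀ i v, ((F i).filter (v ∈ ·)).card ≤ 2) (hm : ∀ i, (F i).card ≤ S.m) :
    ∑ i, (F i).card ≤ (S.m + 2 + d + 2).choose 2 := by
  have h2 : ∀ i, ∀ e ∈ F i, e.card = 2 := fun i e he =>
    (mem_powersetCard.1 (mem_filter.1 (hF i he)).1).2
  choose E hEcard hEdisj hE using fun j : Σ i, F i =>
    exists_card_le_two_meeting_adjacent (F j.1) (h2 j.1) (hdeg j.1) j.2.2
  have key := card_le_choose_of_skew_set_pairs (J := Σ i, F i) (M := S.m + 2) (d := d)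
    (fun j => (j.1 : ℕ)) (fun j => j.2) (fun j => S.transversal j.1 ∪ E j)
    (fun j => (F j.1).filter fun e => Disjoint e (j.2 : Finset α))
    (fun j => h2 j.1 _ j.2.2) ?_ ?_ ?_ ?_ ?_
  · simpa using key
  · intro j
    have h1 := card_union_le (S.transversal j.1) (E j)
    have h3 := hEcard j
    rw [S.card_transversal] at h1
    omega
  · intro j
    exact disjoint_union_right.2 ⟨S.disjoint_transversal_of_mem_link (hF _ j.2.2), hEdisj j⟩
  · intro j C hC
    exact (mem_filter.1 hC).2
  · intro j
    refine lt_of_lt_of_le (card_lt_card ?_) ((hm j.1).trans hd)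
    refine filter_ssubset.2 ⟨j.2, j.2.2, ?_⟩
    rw [disjoint_self_iff_empty, ← card_eq_zero, h2 j.1 _ j.2.2]
    norm_num
  · rintro ⟨i, A, hA⟩ ⟨i', A', hA'⟩ hne hle
    rcases lt_or_eq_of_le hle with hlt | heq
    · left
      rw [disjoint_union_right, not_and_or]
      exact Or.inl (S.not_disjoint_transversal_of_mem_link hlt (hF _ hA'))
    · obtain rfl : i' = i := Fin.ext heq
      by_cases hd' : Disjoint A' A
      · exact Or.inr (mem_filter.2 ⟨hA', hd'⟩)
      · left
        rw [disjoint_union_right, not_and_or]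
        refine Or.inr (hE ⟨i', A, hA⟩ A' hA' ?_ hd')
        rintro rfl
        exact hne rfl

/-- A bound with error term of order `m ^ (3 / 2)`, when `d` is chosen of order `m ^ (1 / 2)`. -/
theorem n_le_choose_add (S : NMSystem α) {d : ℕ} (hd : S.m ≤ (d + 2).choose 2) :
    S.n ≤ (S.m + 2 + d + 2).choose 2 + 2 * S.m := by
  obtain ⟨t, ht⟩ : ∃ t : Fin S.ell, ∀ i, i ≤ t := by
    have h := S.h_ell
    refine ⟨⟨S.ell - 1, by omega⟩, fun i => ?_⟩
    have := i.2
    rw [Fin.le_def]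
    simp only
    omega
  have hex : ∀ i, ∃ F ⊆ S.link i, (∀ v, (F.filter (v ∈ ·)).card ≤ 2) ∧ F.card ≤ S.m ∧
      (i ≠ t → (S.lastPart i).card ≤ F.card + (S.apex i).card) := by
    intro i
    by_cases hi : i = t
    · exact ⟨∅, by simp, by simp, by simp, fun h => absurd hi h⟩
    · obtain ⟨F, h1, h2, h3, h4⟩ := S.exists_subgraph_of_link (lt_of_le_of_ne (ht i) hi)
      exact ⟨F, h1, h2, h3, fun _ => h4⟩
  choose F hF hdeg hm hX using hex
  have h1 := S.sum_card_le_choose hd F hF hdeg hm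
  have h2 := S.sum_card_apex_le ht
  have h3 := S.n_le_sum_card_lastPart
  have h4 : (S.lastPart t).card ≤ S.m := by
    rw [← S.card_transversal t]
    exact card_le_card (filter_subset _ _)
  have h5 : ∑ i ∈ univ.erase t, (S.lastPart i).card
      ≤ ∑ i ∈ univ.erase t, (F i).card + ∑ i ∈ univ.erase t, (S.apex i).card := by
    rw [← sum_add_distrib]
    exact sum_le_sum fun i hi => hX i (ne_of_mem_erase hi)
  have h6 : ∑ i ∈ univ.erase t, (F i).card ≤ ∑ i, (F i).card :=
    sum_le_sum_of_subset (erase_subset _ _)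
  rw [← add_sum_erase univ _ (mem_univ t)] at h3
  omega

end NMSystem

/-- any `(n,m)`-system satisfies
`n ≤ C(m+2,2) + 6 m^{5/3} + 3 m^{4/3} + 9 m - 3`. -/
theorem nm_system_order_bound {α : Type*} [DecidableEq α] (S : NMSystem α) :
    (S.n : ℝ) ≤ (Nat.choose (S.m + 2) 2 : ℝ) + 6 * (S.m : ℝ) ^ ((5 : ℝ) / 3)
      + 3 * (S.m : ℝ) ^ ((4 : ℝ) / 3) + 9 * (S.m : ℝ) - 3 := by
  have hm1 : (1 : ℝ) ≤ (S.m : ℝ) := by exact_mod_cast S.m_pos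
  have hm0 : (0 : ℝ) ≤ (S.m : ℝ) := by linarith
  obtain ⟨x, hx⟩ : ∃ x : ℝ, x = (S.m : ℝ) ^ ((1 : ℝ) / 3) := ⟨_, rfl⟩
  have hx1 : 1 ≤ x := hx ▸ Real.one_le_rpow hm1 (by norm_num)
  have hx3 : (S.m : ℝ) = x ^ 3 := by
    rw [hx, ← Real.rpow_natCast, ← Real.rpow_mul hm0]
    norm_num
  have hx5 : (S.m : ℝ) ^ ((5 : ℝ) / 3) = x ^ 5 := by
    rw [hx, ← Real.rpow_natCast, ← Real.rpow_mul hm0]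
    norm_num
  have hx4 : (S.m : ℝ) ^ ((4 : ℝ) / 3) = x ^ 4 := by
    rw [hx, ← Real.rpow_natCast, ← Real.rpow_mul hm0]
    norm_num
  obtain ⟨d, hd⟩ : ∃ d : ℕ, ⌈x ^ 2⌉₊ = d + 1 :=
    Nat.exists_eq_add_one.2 (Nat.ceil_pos.2 (by positivity))
  have hd1 : x ^ 2 ≤ d + 1 := by
    have := Nat.le_ceil (x ^ 2)
    rw [hd] at this
    exact_mod_cast this
  have hd2 : (d : ℝ) < x ^ 2 := Nat.lt_ceil.1 (by omega)
  have hmd : S.m ≤ (d + 2).choose 2 := by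
    have h : (S.m : ℝ) ≤ ((d + 2).choose 2 : ℕ) := by
      rw [Nat.cast_choose_two, hx3]
      push_cast
      nlinarith [sq_nonneg (x ^ 2 - x), mul_self_le_mul_self (by positivity) hd1]
    exact_mod_cast h
  have hn : (S.n : ℝ) ≤ ((S.m + 2 + d + 2).choose 2 + 2 * S.m : ℕ) := by
    exact_mod_cast S.n_le_choose_add hmd
  rw [hx5, hx4]
  push_cast [Nat.cast_choose_two] at hn ⊢
  rw [hx3] at hn ⊢
  have hx0 : 0 ≤ x - 1 := by linarith
  refine hn.trans ?_
  have hd0 : (0 : ℝ) ≤ d := Nat.cast_nonneg d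
  have e1 : ((d : ℝ) + 2) * x ^ 3 ≤ (x ^ 2 + 2) * x ^ 3 :=
    mul_le_mul_of_nonneg_right (by linarith) (by positivity)
  have e2 : (d : ℝ) * d ≤ x ^ 2 * x ^ 2 := mul_self_le_mul_self hd0 hd2.le
  have e3 : 0 ≤ 5 * x ^ 5 + 5 / 2 * x ^ 4 + 5 * x ^ 3 - 7 / 2 * x ^ 2 - 8 := by
    have h2 : 1 ≤ x ^ 2 := one_le_pow₀ hx1
    have h3 : x ^ 2 ≤ x ^ 3 := pow_le_pow_right₀ hx1 (by norm_num)
    have h4 : x ^ 2 ≤ x ^ 4 := pow_le_pow_right₀ hx1 (by norm_num)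
    have h5 : x ^ 2 ≤ x ^ 5 := pow_le_pow_right₀ hx1 (by norm_num)
    linarith
  nlinarith
end

section
/- There exists a constant C > 0 such that every 3-uniform τ-critical hypergraph H with transversal number τ(H) = t satisfies |V(H)| ≤ C(t+2,2) + C·t^{5/3}, where C(t+2,2) is the binomial coefficient and t^{5/3} is a real power. -/
/-- A set `T` is a transversal of the hypergraph `H`: it meets every edge. -/
def IsTransversal {α : Type} [DecidableEq α] (H : Finset (Finset α)) (T : Finset α) : Prop :=
  ∀ e ∈ H, (e ∩ T).Nonempty

/-- The transversal number `τ(H)`: the minimum size of a transversal of `H`. -/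
noncomputable def transversalNumber {α : Type} [DecidableEq α] (H : Finset (Finset α)) : ℕ :=
  sInf {c : ℕ | ∃ T : Finset α, IsTransversal H T ∧ T.card = c}

open Finset in
/-- Bollobás's weighted set-pair inequality for pairs `(A i, B i)` with `#(A i) = 2`. -/
theorem sum_two_div_le_one_of_crossing {α ι : Type*} [DecidableEq α] (V : Finset α)
    (I : Finset ι) (A B : ι → Finset α) (hA : ∀ i ∈ I, #(A i) = 2)
    (hAV : ∀ i ∈ I, A i ⊆ V) (hBV : ∀ i ∈ I, B i ⊆ V)
    (hdisj : ∀ i ∈ I, Disjoint (A i) (B i))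
    (hcross : ∀ i ∈ I, ∀ j ∈ I, i ≠ j → (A j ∩ B i).Nonempty) :
    ∑ i ∈ I, (2 : ℝ) / ((#(B i) + 1) * (#(B i) + 2)) ≤ 1 := by
  induction hn : #V generalizing V I B with
  | zero =>
    have : I = ∅ := by
      refine eq_empty_of_forall_notMem fun i hi => ?_
      have := card_le_card (hAV i hi)
      have := hA i hi
      omega
    simp [this]
  | succ n ih =>
    by_cases hB : ∃ i ∈ I, B i = ∅
    · obtain ⟨i, hi, hBi⟩ := hB
      have hI : I = {i} := by
        refine eq_singleton_iff_unique_mem.2 ⟨hi, fun j hj => ?_⟩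
        by_contra hne
        simpa [hBi] using hcross i hi j hj (Ne.symm hne)
      simp [hI, hBi]
    push Not at hB
    have hv : ∀ v ∈ V, ∑ i ∈ I with v ∉ A i,
        (2 : ℝ) / ((#((B i).erase v) + 1) * (#((B i).erase v) + 2)) ≤ 1 := by
      intro v hv
      refine ih (V.erase v) (I.filter fun i => v ∉ A i) (fun i => (B i).erase v) ?_ ?_ ?_ ?_ ?_ ?_
      · intro i hi
        exact hA i (mem_filter.1 hi).1
      · intro i hi
        exact subset_erase.2 ⟨hAV i (mem_filter.1 hi).1, (mem_filter.1 hi).2⟩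
      · intro i hi
        exact erase_subset_erase v (hBV i (mem_filter.1 hi).1)
      · intro i hi
        exact (hdisj i (mem_filter.1 hi).1).mono_right (erase_subset _ _)
      · intro i hi j hj hij
        rw [mem_filter] at hi hj
        obtain ⟨x, hx⟩ := hcross i hi.1 j hj.1 hij
        rw [mem_inter] at hx
        exact ⟨x, mem_inter.2 ⟨hx.1, mem_erase.2 ⟨fun h => hj.2 (h ▸ hx.1), hx.2⟩⟩⟩
      · rw [card_erase_of_mem hv, hn, Nat.add_sub_cancel]
    have key : ∀ i ∈ I, ∑ v ∈ V with v ∉ A i,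
        (2 : ℝ) / ((#((B i).erase v) + 1) * (#((B i).erase v) + 2)) =
        (n + 1) * (2 / ((#(B i) + 1) * (#(B i) + 2))) := by
      intro i hi
      have hsplit : V.filter (fun v => v ∉ A i) = B i ∪ (V \ (A i ∪ B i)) := by
        ext v
        have h1 := @hBV i hi v
        have h2 : v ∈ A i → v ∉ B i := fun h => disjoint_left.1 (hdisj i hi) h
        simp only [mem_filter, mem_union, mem_sdiff]
        tauto
      have hd : Disjoint (B i) (V \ (A i ∪ B i)) :=
        disjoint_left.2 fun v h1 h2 => (mem_sdiff.1 h2).2 (mem_union_right _ h1)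
      rw [hsplit, sum_union hd]
      obtain ⟨b, hb⟩ : ∃ b, #(B i) = b + 1 :=
        ⟨#(B i) - 1, by have := card_pos.2 (hB i hi); omega⟩
      have e1 : ∀ v ∈ B i, (2 : ℝ) / ((#((B i).erase v) + 1) * (#((B i).erase v) + 2)) =
          2 / ((b + 1) * (b + 2)) := by
        intro v hv
        rw [card_erase_of_mem hv, hb, Nat.add_sub_cancel]
      have e2 : ∀ v ∈ V \ (A i ∪ B i),
          (2 : ℝ) / ((#((B i).erase v) + 1) * (#((B i).erase v) + 2)) =
          2 / ((b + 1 + 1) * (b + 1 + 2)) := by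
        intro v hv
        have : v ∉ B i := fun h => (mem_sdiff.1 hv).2 (mem_union_right _ h)
        rw [erase_eq_of_notMem this, hb]
        push_cast
        rfl
      have hc : #(V \ (A i ∪ B i)) + (b + 3) = n + 1 := by
        rw [← hn, ← card_sdiff_add_card_eq_card (union_subset (hAV i hi) (hBV i hi)),
          card_union_of_disjoint (hdisj i hi), hA i hi, hb]
        ring
      have hc' : (#(V \ (A i ∪ B i)) : ℝ) = n + 1 - (b + 3) := by
        rw [eq_sub_iff_add_eq]
        exact_mod_cast hc
      rw [sum_congr rfl e1, sum_congr rfl e2, sum_const, sum_const, nsmul_eq_mul, nsmul_eq_mul,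
        hc', hb]
      push_cast
      field_simp
      ring
    have hsum : ∑ v ∈ V, ∑ i ∈ I with v ∉ A i,
        (2 : ℝ) / ((#((B i).erase v) + 1) * (#((B i).erase v) + 2)) ≤ n + 1 := by
      refine (sum_le_sum hv).trans ?_
      simp [hn]
    have hswap : ∑ v ∈ V, ∑ i ∈ I with v ∉ A i,
        (2 : ℝ) / ((#((B i).erase v) + 1) * (#((B i).erase v) + 2)) =
        ∑ i ∈ I, ∑ v ∈ V with v ∉ A i,
        (2 : ℝ) / ((#((B i).erase v) + 1) * (#((B i).erase v) + 2)) := by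
      refine sum_comm' fun v i => ?_
      simp only [mem_filter]
      tauto
    rw [hswap, sum_congr rfl key, ← mul_sum] at hsum
    have : (0 : ℝ) < n + 1 := by positivity
    nlinarith

open Finset in
/-- Bollobás's set-pair inequality for pairs `(A i, B i)` with `#(A i) = 2` and `#(B i) ≤ b`. -/
theorem card_le_choose_of_crossing {α ι : Type*} [DecidableEq α]
    (I : Finset ι) (A B : ι → Finset α) (b : ℕ) (hA : ∀ i ∈ I, #(A i) = 2)
    (hB : ∀ i ∈ I, #(B i) ≤ b) (hdisj : ∀ i ∈ I, Disjoint (A i) (B i))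
    (hcross : ∀ i ∈ I, ∀ j ∈ I, i ≠ j → (A j ∩ B i).Nonempty) :
    #I ≤ (b + 2).choose 2 := by
  have h := sum_two_div_le_one_of_crossing (I.biUnion fun i => A i ∪ B i) I A B hA
    (fun i hi => subset_union_left.trans (subset_biUnion_of_mem (fun i => A i ∪ B i) hi))
    (fun i hi => subset_union_right.trans (subset_biUnion_of_mem (fun i => A i ∪ B i) hi))
    hdisj hcross
  have h2 : ∑ i ∈ I, (2 : ℝ) / ((b + 1) * (b + 2)) ≤ 1 := by
    refine (sum_le_sum fun i hi => ?_).trans h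
    have : (#(B i) : ℝ) ≤ b := by exact_mod_cast hB i hi
    gcongr
  rw [sum_const, nsmul_eq_mul, mul_div_assoc', div_le_one (by positivity)] at h2
  have h3 : #I * 2 ≤ (b + 1) * (b + 2) := by exact_mod_cast h2
  rw [Nat.choose_two_right, Nat.le_div_iff_mul_le (by norm_num)]
  calc #I * 2 ≤ (b + 1) * (b + 2) := h3
    _ = (b + 2) * (b + 2 - 1) := by rw [Nat.add_succ_sub_one, mul_comm]

open Finset in
/-- Hall's marriage theorem on a finite set of left vertices. -/
theorem exists_injOn_of_forall_card_le_biUnion {ι β : Type*} [DecidableEq β] [Nonempty β]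
    (R : Finset ι) (N : ι → Finset β) (h : ∀ R' ⊆ R, #R' ≤ #(R'.biUnion N)) :
    ∃ f : ι → β, Set.InjOn f R ∧ ∀ r ∈ R, f r ∈ N r := by
  classical
  obtain ⟨f, hf, hfN⟩ := (all_card_le_biUnion_card_iff_exists_injective
    fun r : R => N r).1 fun s => by
      have := h (s.map (Function.Embedding.subtype _)) fun x hx => by
        obtain ⟨y, -, rfl⟩ := mem_map.1 hx
        exact y.2
      rw [card_map] at this
      refine this.trans_eq ?_
      congr 1
      ext x
      simp
  refine ⟨fun r => if hr : r ∈ R then f ⟨r, hr⟩ else Classical.arbitrary β, ?_, ?_⟩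
  · intro a ha b hb hab
    rw [mem_coe] at ha hb
    simp only [ha, hb, dite_true] at hab
    exact congrArg Subtype.val (hf hab)
  · intro r hr
    simp only [hr, dite_true]
    exact hfN ⟨r, hr⟩

open Finset in
/-- The deficiency version of Hall's marriage theorem. -/
theorem exists_injOn_of_forall_card_le_biUnion_add {ι β : Type*} [DecidableEq β] [Nonempty β]
    (R : Finset ι) (N : ι → Finset β) (d : ℕ) (h : ∀ R' ⊆ R, #R' ≤ #(R'.biUnion N) + d) :
    ∃ R₁ ⊆ R, #R ≤ #R₁ + d ∧ ∃ f : ι → β, Set.InjOn f R₁ ∧ ∀ r ∈ R₁, f r ∈ N r := by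
  classical
  obtain ⟨g, hg, hgN⟩ := exists_injOn_of_forall_card_le_biUnion R
    (fun r => (N r).disjSum (univ : Finset (Fin d))) fun R' hR' => by
      rcases R'.eq_empty_or_nonempty with rfl | ⟨r₀, hr₀⟩
      · simp
      have hsub : (R'.biUnion N).disjSum (univ : Finset (Fin d)) ⊆
          R'.biUnion fun r => (N r).disjSum (univ : Finset (Fin d)) := by
        rintro (b | i) hx
        · simpa using hx
        · simpa using ⟨r₀, hr₀⟩
      refine (h R' hR').trans (le_trans ?_ (card_le_card hsub))
      simp [card_disjSum]
  refine ⟨R.filter fun r => (g r).isLeft, filter_subset _ _, ?_,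
    fun r => (g r).elim id fun _ => Classical.arbitrary β, ?_, ?_⟩
  · rw [← card_filter_add_card_filter_not (s := R) fun r => (g r).isLeft = true]
    gcongr
    have : #(R.filter fun r => ¬(g r).isLeft = true) ≤
        #((univ : Finset (Fin d)).image (Sum.inr : Fin d → β ⊕ Fin d)) := by
      refine card_le_card_of_injOn g ?_ (hg.mono fun x hx => (mem_filter.1 hx).1)
      intro r hr
      have hr := (mem_filter.1 hr).2
      cases hgr : g r <;> simp_all
    exact this.trans (card_image_le.trans (by simp))
  · intro a ha b hb hab
    simp only [coe_filter, Set.mem_ofPred_eq] at ha hb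
    refine hg ha.1 hb.1 ?_
    obtain ⟨x, hx⟩ := Sum.isLeft_iff.1 ha.2
    obtain ⟨y, hy⟩ := Sum.isLeft_iff.1 hb.2
    simp_all
  · intro r hr
    obtain ⟨hr, hl⟩ := mem_filter.1 hr
    obtain ⟨x, hx⟩ := Sum.isLeft_iff.1 hl
    have := hgN r hr
    simp_all

section CriticalSystem

open Finset

variable {α : Type} [DecidableEq α] {H : Finset (Finset α)} {t s : ℕ} {T : Finset α → Finset α}

/-- `H` is a `3`-uniform hypergraph all of whose transversals have at least `t` elements, and
for every edge `e` the set `T e` is a transversal of `H \ {e}` with fewer than `t` elements. -/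
structure CriticalSystem (H : Finset (Finset α)) (t : ℕ) (T : Finset α → Finset α) : Prop where
  card_edge : ∀ e ∈ H, #e = 3
  le_card : ∀ S, IsTransversal H S → t ≤ #S
  card_lt : ∀ e ∈ H, #(T e) < t
  disjoint : ∀ e ∈ H, Disjoint e (T e)
  meets : ∀ e ∈ H, ∀ h ∈ H, h ≠ e → (h ∩ T e).Nonempty

/-- The sets that form an edge of `H` together with the vertex `p`. -/
def hyperlink (H : Finset (Finset α)) (p : α) : Finset (Finset α) :=
  {h ∈ H | p ∈ h}.image fun h => h.erase p

/-- The vertices in `X₀` that lie in an edge with two further vertices outside `X`. -/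
def doubleCentre (H : Finset (Finset α)) (X₀ X : Finset α) : Finset α :=
  {x ∈ X₀ | ∃ h ∈ H, x ∈ h ∧ 2 ≤ #(h \ X)}

theorem mem_hyperlink {p : α} {A : Finset α} : A ∈ hyperlink H p ↔ p ∉ A ∧ insert p A ∈ H := by
  simp only [hyperlink, mem_image, mem_filter]
  constructor
  · rintro ⟨h, ⟨hh, hp⟩, rfl⟩
    exact ⟨notMem_erase _ _, by rwa [insert_erase hp]⟩
  · rintro ⟨hp, hA⟩
    exact ⟨_, ⟨hA, mem_insert_self _ _⟩, erase_insert hp⟩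

theorem erase_mem_hyperlink {p : α} {h : Finset α} (hh : h ∈ H) (hp : p ∈ h) :
    h.erase p ∈ hyperlink H p :=
  mem_image.2 ⟨h, mem_filter.2 ⟨hh, hp⟩, rfl⟩

namespace CriticalSystem

theorem card_of_mem_hyperlink (C : CriticalSystem H t T) {p : α} {A : Finset α}
    (hA : A ∈ hyperlink H p) : #A = 2 := by
  obtain ⟨hp, hA⟩ := mem_hyperlink.1 hA
  have := C.card_edge _ hA
  rw [card_insert_of_notMem hp] at this
  omega

theorem nonempty_of_mem_hyperlink (C : CriticalSystem H t T) {p : α} {A : Finset α}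
    (hA : A ∈ hyperlink H p) : A.Nonempty :=
  card_pos.1 (by rw [C.card_of_mem_hyperlink hA]; norm_num)

/-- If every edge contains at most one vertex of `S`, then the vertices of `S` have distinct
representatives in their links. -/
theorem exists_injOn_hyperlink (C : CriticalSystem H t T) (S : Finset α)
    (hS : ∀ h ∈ H, #(h ∩ S) ≤ 1) (hcov : ∀ p ∈ S, ∃ h ∈ H, p ∈ h) :
    ∃ f : α → Finset α, Set.InjOn f S ∧ ∀ p ∈ S, f p ∈ hyperlink H p := by
  have uniq : ∀ h ∈ H, ∀ p ∈ h, ∀ q ∈ h, p ∈ S → q ∈ S → p = q := fun h hh p hp q hq hpS hqS =>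
    card_le_one.1 (hS h hh) p (mem_inter.2 ⟨hp, hpS⟩) q (mem_inter.2 ⟨hq, hqS⟩)
  refine exists_injOn_of_forall_card_le_biUnion S (hyperlink H) fun R hR => ?_
  induction R using Finset.strongInduction with
  | H R ih =>
  by_contra! hlt
  set N := R.biUnion (hyperlink H) with hN
  obtain ⟨p₀, hp₀⟩ : R.Nonempty := card_pos.1 (by omega)
  obtain ⟨e, he, hpe⟩ := hcov p₀ (hR hp₀)
  set N₀ := N.filter fun A => Disjoint A (T e) with hN₀
  set K := R.filter fun p => ∃ A ∈ N₀, A ∈ hyperlink H p with hK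
  have hp₀K : p₀ ∈ K := by
    refine mem_filter.2 ⟨hp₀, e.erase p₀, mem_filter.2 ⟨?_, ?_⟩, erase_mem_hyperlink he hpe⟩
    · exact mem_biUnion.2 ⟨p₀, hp₀, erase_mem_hyperlink he hpe⟩
    · exact (C.disjoint e he).mono_left (erase_subset _ _)
  have hKsub : K ⊆ insert p₀ (T e ∩ R) := by
    intro p hp
    obtain ⟨hpR, A, hA, hAp⟩ := mem_filter.1 hp
    have hd := (mem_filter.1 hA).2
    obtain ⟨hpA, hins⟩ := mem_hyperlink.1 hAp
    by_cases hpe' : insert p A = e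
    · rw [mem_insert]
      left
      exact uniq e he p (hpe' ▸ mem_insert_self p A) p₀ hpe (hR hpR) (hR hp₀)
    · obtain ⟨x, hx⟩ := C.meets e he _ hins hpe'
      rw [mem_inter, mem_insert] at hx
      rcases hx with ⟨rfl | hxA, hxT⟩
      · exact mem_insert_of_mem (mem_inter.2 ⟨hxT, hpR⟩)
      · exact absurd hxT (disjoint_left.1 hd hxA)
  have hcK := (card_le_card hKsub).trans (card_insert_le _ _)
  have hrest : #(R \ K) ≤ #(N \ N₀) := by
    refine (ih (R \ K) ?_ (sdiff_subset.trans hR)).trans (card_le_card ?_)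
    · exact ssubset_of_subset_of_ne sdiff_subset fun h => by
        rw [← h] at hp₀
        exact (mem_sdiff.1 hp₀).2 hp₀K
    · intro A hA
      obtain ⟨p, hp, hAp⟩ := mem_biUnion.1 hA
      rw [mem_sdiff] at hp
      refine mem_sdiff.2 ⟨mem_biUnion.2 ⟨p, hp.1, hAp⟩, fun hA₀ => hp.2 ?_⟩
      exact mem_filter.2 ⟨hp.1, A, hA₀, hAp⟩
  have h1 := card_sdiff_add_card_eq_card (show K ⊆ R from filter_subset _ _)
  have h2 := card_sdiff_add_card_eq_card (show N₀ ⊆ N from filter_subset _ _)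
  have hne : ∀ A ∈ N₀, A.Nonempty := fun A hA => by
    obtain ⟨p, -, hAp⟩ := mem_biUnion.1 (mem_filter.1 hA).1
    exact C.nonempty_of_mem_hyperlink hAp
  have : Nonempty α := ⟨p₀⟩
  choose! c hc using hne
  have htrans : IsTransversal H ((T e \ R) ∪ N₀.image c) := by
    intro h hh
    by_cases hhR : ∃ p ∈ h, p ∈ R
    · obtain ⟨p, hp, hpR⟩ := hhR
      have hlink := erase_mem_hyperlink hh hp
      by_cases hd : Disjoint (h.erase p) (T e)
      · have hA : h.erase p ∈ N₀ := mem_filter.2 ⟨mem_biUnion.2 ⟨p, hpR, hlink⟩, hd⟩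
        exact ⟨c (h.erase p), mem_inter.2 ⟨mem_of_mem_erase (hc _ hA),
          mem_union_right _ (mem_image_of_mem c hA)⟩⟩
      · obtain ⟨x, hx, hxT⟩ := not_disjoint_iff.1 hd
        rw [mem_erase] at hx
        refine ⟨x, mem_inter.2 ⟨hx.2, mem_union_left _ (mem_sdiff.2 ⟨hxT, fun hxR => ?_⟩)⟩⟩
        exact hx.1 (uniq h hh x hx.2 p hp (hR hxR) (hR hpR))
    · have hhe : h ≠ e := fun h' => hhR ⟨p₀, h' ▸ hpe, hp₀⟩
      obtain ⟨x, hx⟩ := C.meets e he h hh hhe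
      rw [mem_inter] at hx
      exact ⟨x, mem_inter.2 ⟨hx.1, mem_union_left _ (mem_sdiff.2 ⟨hx.2, fun hxR =>
        hhR ⟨x, hx.1, hxR⟩⟩)⟩⟩
  have h3 := (C.le_card _ htrans).trans (card_union_le _ _)
  have h4 : #(N₀.image c) ≤ #N₀ := card_image_le
  have h5 := card_sdiff_add_card_inter (T e) R
  have h6 := C.card_lt e he
  omega

/-- A set `X ⊇ X₀` of controlled size such that every `T e` contains all but `s` of the elements
of `X₀` that lie in an edge with two vertices outside `X`. -/
theorem exists_core (C : CriticalSystem H t T) (X₀ : Finset α) (hX₀ : #X₀ ≤ t) (hs : 0 < s) :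
    ∃ (X : Finset α) (r : ℕ), X₀ ⊆ X ∧ #X ≤ t + r * (t + 2) ∧ r * s ≤ t ∧
      ∀ e ∈ H, #(doubleCentre H X₀ X \ T e) ≤ s := by
  suffices ∀ (n : ℕ) (X : Finset α) (r : ℕ), X₀ ⊆ X → #X ≤ t + r * (t + 2) →
      r * s + #(doubleCentre H X₀ X) ≤ t → #(doubleCentre H X₀ X) = n →
      ∃ (X : Finset α) (r : ℕ), X₀ ⊆ X ∧ #X ≤ t + r * (t + 2) ∧ r * s ≤ t ∧
        ∀ e ∈ H, #(doubleCentre H X₀ X \ T e) ≤ s from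
    this _ X₀ 0 subset_rfl (by simpa using hX₀)
      (by rw [zero_mul, zero_add]; exact (card_le_card (filter_subset _ _)).trans hX₀) rfl
  intro n
  induction n using Nat.strong_induction_on with
  | _ n ih =>
  intro X r hX hcard hr hn
  by_cases hgood : ∀ e ∈ H, #(doubleCentre H X₀ X \ T e) ≤ s
  · exact ⟨X, r, hX, hcard, by omega, hgood⟩
  push Not at hgood
  obtain ⟨e, he, hes⟩ := hgood
  have hsub : doubleCentre H X₀ (X ∪ (T e ∪ e)) ⊆ doubleCentre H X₀ X ∩ T e := by
    intro x hx
    obtain ⟨hxX, h, hh, hxh, h2⟩ := mem_filter.1 hx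
    have hmono : h \ (X ∪ (T e ∪ e)) ⊆ h \ X := sdiff_subset_sdiff subset_rfl subset_union_left
    refine mem_inter.2 ⟨mem_filter.2 ⟨hxX, h, hh, hxh, h2.trans (card_le_card hmono)⟩, ?_⟩
    by_contra hxT
    by_cases hhe : h = e
    · subst hhe
      rw [sdiff_eq_empty_iff_subset.2 (subset_union_right.trans subset_union_right)] at h2
      simp at h2
    · obtain ⟨y, hy⟩ := C.meets e he h hh hhe
      rw [mem_inter] at hy
      have hxy : x ≠ y := fun h' => hxT (h' ▸ hy.2)
      have h3 : h \ (X ∪ (T e ∪ e)) ⊆ (h.erase x).erase y := by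
        intro z hz
        simp only [mem_sdiff, mem_union, not_or] at hz
        refine mem_erase.2 ⟨?_, mem_erase.2 ⟨?_, hz.1⟩⟩
        · rintro rfl
          exact hz.2.2.1 hy.2
        · rintro rfl
          exact hz.2.1 (hX hxX)
      have h4 := card_le_card h3
      rw [card_erase_of_mem (mem_erase.2 ⟨hxy.symm, hy.1⟩), card_erase_of_mem hxh,
        C.card_edge h hh] at h4
      omega
  have h1 := card_le_card hsub
  have h2 := card_sdiff_add_card_inter (doubleCentre H X₀ X) (T e)
  refine ih _ (by omega) (X ∪ (T e ∪ e)) (r + 1) (hX.trans subset_union_left) ?_ ?_ rfl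
  · have h3 := (card_union_le X (T e ∪ e)).trans
      (Nat.add_le_add_left (card_union_le (T e) e) _)
    have h4 := C.card_lt e he
    have h5 := C.card_edge e he
    rw [add_mul]
    omega
  · rw [add_mul]
    omega

/-- Set pairs built from distinct link pairs inside `Y` with private vertices. -/
theorem card_le_choose_of_injOn (C : CriticalSystem H t T) {Q Y Z : Finset α}
    {f : α → Finset α} (hf : ∀ p ∈ Q, f p ∈ hyperlink H p) (hfY : ∀ p ∈ Q, f p ⊆ Y)
    (hinj : Set.InjOn f Q) (hQY : Disjoint Q Y) (hQZ : Disjoint Q Z) (hYZ : Disjoint Y Z)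
    (hZ : ∀ e ∈ H, #(Z \ T e) ≤ s) : #Q ≤ (t + s - #Z + 2).choose 2 := by
  rcases Q.eq_empty_or_nonempty with rfl | ⟨q, -⟩
  · simp
  have : Nonempty α := ⟨q⟩
  have hc2 : ∀ p ∈ Q, #(f p) = 2 := fun p hp => C.card_of_mem_hyperlink (hf p hp)
  have hE : ∀ p ∈ Q, insert p (f p) ∈ H := fun p hp => (mem_hyperlink.1 (hf p hp)).2
  have hne : ∀ p w, p ∈ Q → w ∈ Q → p ≠ w → (f w \ f p).Nonempty := by
    intro p w hp hw hpw
    rw [sdiff_nonempty]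
    intro hsub
    exact hpw (hinj hp hw (eq_of_subset_of_card_le hsub (by rw [hc2 p hp, hc2 w hw])).symm)
  choose! c hc using hne
  set U : α → Finset α := fun p => T (insert p (f p)) with hU
  have hpU : ∀ p ∈ Q, Disjoint (insert p (f p)) (U p) := fun p hp => C.disjoint _ (hE p hp)
  refine card_le_choose_of_crossing Q f
    (fun p => (U p ∩ Y) ∪ (U p ∩ Q).image (c p)) _ hc2 ?_ ?_ ?_
  · intro p hp
    have h1 : #((U p ∩ Y) ∪ (U p ∩ Q).image (c p)) ≤ #(U p ∩ Y) + #(U p ∩ Q) :=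
      (card_union_le _ _).trans (Nat.add_le_add_left card_image_le _)
    have h2 : #(U p ∩ Y) + #(U p ∩ Q) ≤ #(U p \ Z) := by
      rw [← card_union_of_disjoint
        (hQY.symm.mono inter_subset_right inter_subset_right)]
      refine card_le_card fun x hx => ?_
      have h3 : x ∈ Z → x ∉ Q := fun h => disjoint_right.1 hQZ h
      have h4 : x ∈ Z → x ∉ Y := fun h => disjoint_right.1 hYZ h
      simp only [mem_union, mem_inter, mem_sdiff] at hx ⊢
      tauto
    have h3 := C.card_lt _ (hE p hp)
    have h4 := hZ _ (hE p hp)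
    have h5 := card_sdiff_add_card_inter (U p) Z
    have h6 := card_sdiff_add_card_inter Z (U p)
    rw [inter_comm] at h6
    change #(U p) < t at h3
    change #(Z \ U p) ≤ s at h4
    omega
  · intro p hp
    refine disjoint_union_right.2 ⟨?_, disjoint_right.2 ?_⟩
    · exact (hpU p hp).mono (subset_insert _ _) inter_subset_left
    · intro x hx
      obtain ⟨w, hw, rfl⟩ := mem_image.1 hx
      rw [mem_inter] at hw
      refine (mem_sdiff.1 (hc p w hp hw.2 ?_)).2
      rintro rfl
      exact disjoint_left.1 (hpU p hp) (mem_insert_self _ _) hw.1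
  · intro p hp w hw hpw
    have hwp : insert w (f w) ≠ insert p (f p) := by
      intro h
      have h1 : w ∈ insert p (f p) := h ▸ mem_insert_self _ _
      rcases mem_insert.1 h1 with h1 | h1
      · exact hpw h1.symm
      · exact disjoint_left.1 hQY hw (hfY p hp h1)
    obtain ⟨x, hx⟩ := C.meets _ (hE p hp) _ (hE w hw) hwp
    rw [mem_inter, mem_insert] at hx
    rcases hx with ⟨rfl | hxw, hxU⟩
    · refine ⟨c p x, mem_inter.2 ⟨(mem_sdiff.1 (hc p x hp hw hpw)).1, mem_union_right _ ?_⟩⟩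
      exact mem_image_of_mem _ (mem_inter.2 ⟨hxU, hw⟩)
    · exact ⟨x, mem_inter.2 ⟨hxw, mem_union_left _ (mem_inter.2 ⟨hxU, hfY w hw hxw⟩)⟩⟩

theorem erase_subset_of_disjoint_doubleCentre {X₀ X h : Finset α} {p : α}
    (hX₀ : IsTransversal H X₀) (hX : X₀ ⊆ X) (hh : h ∈ H) (hp : p ∈ h) (hpX : p ∉ X)
    (hd : Disjoint (h.erase p) (doubleCentre H X₀ X)) :
    h.erase p ⊆ X \ doubleCentre H X₀ X := by
  refine subset_sdiff.2 ⟨fun y hy => ?_, hd⟩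
  by_contra hyX
  rw [mem_erase] at hy
  obtain ⟨x, hx⟩ := hX₀ h hh
  rw [mem_inter] at hx
  have hxp : x ≠ p := fun h' => hpX (hX (h' ▸ hx.2))
  refine disjoint_left.1 hd (mem_erase.2 ⟨hxp, hx.1⟩) (mem_filter.2 ⟨hx.2, h, hh, hx.1, ?_⟩)
  exact one_lt_card.2 ⟨y, mem_sdiff.2 ⟨hy.2, hyX⟩, p, mem_sdiff.2 ⟨hp, hpX⟩, hy.1⟩

/-- A part of `T e` outside the core `X` is matched, up to `s` elements, into link pairs that
avoid `T e`. -/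
theorem exists_matching_of_subset (C : CriticalSystem H t T) {X₀ X R e : Finset α}
    (hX₀ : IsTransversal H X₀) (hX : X₀ ⊆ X)
    (hZ : ∀ e ∈ H, #(doubleCentre H X₀ X \ T e) ≤ s) (he : e ∈ H) (hR : R ⊆ T e)
    (hRX : Disjoint R X) :
    ∃ R₁ ⊆ R, #R ≤ #R₁ + s ∧ ∃ f : α → Finset α, Set.InjOn f R₁ ∧ ∀ p ∈ R₁,
      f p ∈ hyperlink H p ∧ f p ⊆ X \ doubleCentre H X₀ X ∧ Disjoint (f p) (T e) := by
  set Z := doubleCentre H X₀ X with hZdef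
  have hZX : Z ⊆ X := (filter_subset _ _).trans hX
  suffices ∀ R' ⊆ R, #R' ≤ #(R'.biUnion fun p =>
      {A ∈ hyperlink H p | A ⊆ X \ Z ∧ Disjoint A (T e)}) + s by
    simpa only [mem_filter] using exists_injOn_of_forall_card_le_biUnion_add R _ s this
  intro R' hR'
  set N := R'.biUnion fun p => {A ∈ hyperlink H p | A ⊆ X \ Z ∧ Disjoint A (T e)} with hN
  have hne : ∀ A ∈ N, A.Nonempty := fun A hA => by
    obtain ⟨p, -, hAp⟩ := mem_biUnion.1 hA
    exact C.nonempty_of_mem_hyperlink (mem_filter.1 hAp).1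
  obtain ⟨v, hv⟩ : e.Nonempty := card_pos.1 (by rw [C.card_edge e he]; norm_num)
  have : Nonempty α := ⟨v⟩
  choose! c hc using hne
  have htrans : IsTransversal H (insert v (((T e \ R') ∪ (Z \ T e)) ∪ N.image c)) := by
    intro h hh
    by_cases hhe : h = e
    · subst hhe
      exact ⟨v, mem_inter.2 ⟨hv, mem_insert_self _ _⟩⟩
    obtain ⟨p, hp⟩ := C.meets e he h hh hhe
    rw [mem_inter] at hp
    by_cases hpR : p ∈ R'
    · have hpX : p ∉ X := disjoint_left.1 hRX (hR' hpR)
      by_cases hd : Disjoint (h.erase p) Z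
      · have hsub := erase_subset_of_disjoint_doubleCentre hX₀ hX hh hp.1 hpX hd
        by_cases hdT : Disjoint (h.erase p) (T e)
        · have hA : h.erase p ∈ N := mem_biUnion.2 ⟨p, hpR, mem_filter.2
            ⟨erase_mem_hyperlink hh hp.1, hsub, hdT⟩⟩
          exact ⟨c (h.erase p), mem_inter.2 ⟨mem_of_mem_erase (hc _ hA),
            mem_insert_of_mem (mem_union_right _ (mem_image_of_mem c hA))⟩⟩
        · obtain ⟨x, hx, hxT⟩ := not_disjoint_iff.1 hdT
          refine ⟨x, mem_inter.2 ⟨mem_of_mem_erase hx, mem_insert_of_mem (mem_union_left _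
            (mem_union_left _ (mem_sdiff.2 ⟨hxT, fun hxR => ?_⟩)))⟩⟩
          exact disjoint_left.1 hRX (hR' hxR) (mem_sdiff.1 (hsub hx)).1
      · obtain ⟨x, hx, hxZ⟩ := not_disjoint_iff.1 hd
        refine ⟨x, mem_inter.2 ⟨mem_of_mem_erase hx, mem_insert_of_mem (mem_union_left _ ?_)⟩⟩
        by_cases hxT : x ∈ T e
        · exact mem_union_left _ (mem_sdiff.2 ⟨hxT, fun hxR =>
            disjoint_left.1 hRX (hR' hxR) (hZX hxZ)⟩)
        · exact mem_union_right _ (mem_sdiff.2 ⟨hxZ, hxT⟩)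
    · exact ⟨p, mem_inter.2 ⟨hp.1, mem_insert_of_mem (mem_union_left _ (mem_union_left _
        (mem_sdiff.2 ⟨hp.2, hpR⟩)))⟩⟩
  have h1 := (C.le_card _ htrans).trans (card_insert_le _ _)
  have h2 := card_union_le ((T e \ R') ∪ (Z \ T e)) (N.image c)
  have h3 := card_union_le (T e \ R') (Z \ T e)
  have h4 : #(N.image c) ≤ #N := card_image_le
  have h5 := card_sdiff_add_card_eq_card (hR'.trans hR)
  have h6 := C.card_lt e he
  have h7 := hZ e he
  omega

/-- `M` is matched by `f` to distinct link pairs inside `Y`, none of which belongs to the link of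
a vertex of `S`. -/
structure IsPartialMatching (H : Finset (Finset α)) (Y S M : Finset α)
    (f : α → Finset α) : Prop where
  disjoint : Disjoint S M
  mem_link : ∀ m ∈ M, f m ∈ hyperlink H m
  subset : ∀ m ∈ M, f m ⊆ Y
  injOn : Set.InjOn f M
  notMem_link : ∀ p ∈ S, ∀ m ∈ M, f m ∉ hyperlink H p

/-- The vertices of `P` split, up to a few, into a matched part `M` and a part `S` that meets
every `T e` in fewer than `k` vertices. -/
theorem exists_isPartialMatching (C : CriticalSystem H t T) {X₀ X P : Finset α} {k : ℕ}
    (hX₀ : IsTransversal H X₀) (hX : X₀ ⊆ X)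
    (hZ : ∀ e ∈ H, #(doubleCentre H X₀ X \ T e) ≤ s) (hPX : Disjoint P X) (hk : 0 < k) :
    ∃ (S M : Finset α) (f : α → Finset α) (r : ℕ),
      IsPartialMatching H (X \ doubleCentre H X₀ X) S M f ∧ S ⊆ P ∧ M ⊆ P ∧
      #P ≤ #S + #M + r * (s + 3) ∧ r * k ≤ #M + r * s ∧ ∀ e ∈ H, #(T e ∩ S) < k := by
  set Y := X \ doubleCentre H X₀ X with hY
  suffices ∀ (n : ℕ) (S M : Finset α) (f : α → Finset α) (r : ℕ),
      IsPartialMatching H Y S M f → S ⊆ P → M ⊆ P →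
      #P ≤ #S + #M + r * (s + 3) → r * k ≤ #M + r * s → #S = n →
      ∃ (S M : Finset α) (f : α → Finset α) (r : ℕ),
        IsPartialMatching H Y S M f ∧ S ⊆ P ∧ M ⊆ P ∧
        #P ≤ #S + #M + r * (s + 3) ∧ r * k ≤ #M + r * s ∧ ∀ e ∈ H, #(T e ∩ S) < k from
    this _ P ∅ (fun _ => ∅) 0 ⟨by simp, by simp, by simp, by simp, by simp⟩ subset_rfl
      (by simp) (by simp) (by simp) rfl
  intro n
  induction n using Nat.strong_induction_on with
  | _ n ih =>
  intro S M f r hf hSP hMP hcard hr hn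
  by_cases hgood : ∀ e ∈ H, #(T e ∩ S) < k
  · exact ⟨S, M, f, r, hf, hSP, hMP, hcard, hr, hgood⟩
  push Not at hgood
  obtain ⟨e, he, hek⟩ := hgood
  obtain ⟨R, hR, hRcard, g, hg, hgR⟩ := C.exists_matching_of_subset hX₀ hX hZ he
    (R := T e ∩ S) inter_subset_left (hPX.mono_left (inter_subset_right.trans hSP))
  have hRS : R ⊆ S := hR.trans inter_subset_right
  have hSMR : Disjoint R M := hf.disjoint.mono_left hRS
  obtain ⟨F, hfeq, hgeq⟩ : ∃ F : α → Finset α, (∀ m ∈ M, F m = f m) ∧ ∀ m ∈ R, F m = g m :=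
    ⟨fun p => if p ∈ M then f p else g p, fun m hm => if_pos hm,
      fun m hm => if_neg (disjoint_left.1 hSMR hm)⟩
  have hcross : ∀ m ∈ M, ∀ p ∈ R, f m ≠ g p := fun m hm p hp h =>
    hf.notMem_link p (hRS hp) m hm (h ▸ (hgR p hp).1)
  have hlt : #(S \ (T e ∩ S ∪ e)) < #S := by
    refine card_lt_card (ssubset_of_subset_of_ne sdiff_subset fun h => ?_)
    obtain ⟨x, hx⟩ : (T e ∩ S).Nonempty := card_pos.1 (by omega)
    have hxS := mem_of_mem_inter_right hx
    rw [← h, mem_sdiff] at hxS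
    exact hxS.2 (mem_union_left _ hx)
  have hMR : #(M ∪ R) = #M + #R := card_union_of_disjoint hSMR.symm
  refine ih _ (by omega) (S \ (T e ∩ S ∪ e)) (M ∪ R) F
    (r + 1) ?_ (sdiff_subset.trans hSP) (union_subset hMP (hRS.trans hSP)) ?_ ?_ rfl
  · refine ⟨?_, ?_, ?_, ?_, ?_⟩
    · refine disjoint_union_right.2 ⟨hf.disjoint.mono_left sdiff_subset, ?_⟩
      exact disjoint_left.2 fun x hx hxR => (mem_sdiff.1 hx).2 (mem_union_left _ (hR hxR))
    · intro m hm
      rcases mem_union.1 hm with hm | hm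
      · rw [hfeq m hm]
        exact hf.mem_link m hm
      · rw [hgeq m hm]
        exact (hgR m hm).1
    · intro m hm
      rcases mem_union.1 hm with hm | hm
      · rw [hfeq m hm]
        exact hf.subset m hm
      · rw [hgeq m hm]
        exact (hgR m hm).2.1
    · intro a ha b hb hab
      rw [mem_coe, mem_union] at ha hb
      rcases ha with ha | ha <;> rcases hb with hb | hb
      · rw [hfeq a ha, hfeq b hb] at hab
        exact hf.injOn ha hb hab
      · rw [hfeq a ha, hgeq b hb] at hab
        exact absurd hab (hcross a ha b hb)
      · rw [hgeq a ha, hfeq b hb] at hab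
        exact absurd hab.symm (hcross b hb a ha)
      · rw [hgeq a ha, hgeq b hb] at hab
        exact hg ha hb hab
    · intro p hp m hm
      rw [mem_sdiff, mem_union, not_or] at hp
      rcases mem_union.1 hm with hm | hm
      · rw [hfeq m hm]
        exact hf.notMem_link p hp.1 m hm
      · rw [hgeq m hm, mem_hyperlink]
        rintro ⟨-, hins⟩
        obtain ⟨x, hx⟩ := C.meets e he _ hins fun h => hp.2.2 (h ▸ mem_insert_self _ _)
        rw [mem_inter, mem_insert] at hx
        rcases hx with ⟨rfl | hxg, hxT⟩
        · exact hp.2.1 (mem_inter.2 ⟨hxT, hp.1⟩)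
        · exact disjoint_left.1 (hgR m hm).2.2 hxg hxT
  · have h1 := card_sdiff_add_card_inter S (T e ∩ S ∪ e)
    have h2 := (card_le_card (inter_subset_right : S ∩ (T e ∩ S ∪ e) ⊆ _)).trans
      (card_union_le _ _)
    have h3 := C.card_edge e he
    rw [hMR, add_mul]
    omega
  · rw [hMR, add_mul, add_mul]
    omega

end CriticalSystem

/-- Counting distinct pairs that meet `Z`, where each `x ∈ Z` has at most `b` partners
outside `Z`. -/
theorem card_le_of_injOn_pairs_meeting {Q Z : Finset α} {f : α → Finset α} {W : α → Finset α}
    {b : ℕ} (hf : ∀ p ∈ Q, #(f p) = 2) (hinj : Set.InjOn f Q)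
    (hZ : ∀ p ∈ Q, ¬Disjoint (f p) Z) (hW : ∀ x ∈ Z, #(W x) ≤ b)
    (hfW : ∀ p ∈ Q, ∀ x ∈ f p, x ∈ Z → ∀ y ∈ f p, y ∉ Z → y ∈ W x) :
    #Q ≤ (#Z).choose 2 + #Z * b := by
  have hmaps : Set.MapsTo f Q
      (Z.powersetCard 2 ∪ Z.biUnion fun x => (W x).image fun y => {x, y} : Finset (Finset α)) := by
    intro p hp
    rw [mem_coe, mem_union]
    by_cases hsub : f p ⊆ Z
    · exact Or.inl (mem_powersetCard.2 ⟨hsub, hf p hp⟩)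
    · right
      obtain ⟨x, hx, hxZ⟩ := not_disjoint_iff.1 (hZ p hp)
      obtain ⟨y, hy, hyZ⟩ := not_subset.1 hsub
      refine mem_biUnion.2 ⟨x, hxZ, mem_image.2 ⟨y, hfW p hp x hx hxZ y hy hyZ, ?_⟩⟩
      refine eq_of_subset_of_card_le (insert_subset hx (singleton_subset_iff.2 hy)) ?_
      have hxy : x ≠ y := fun h => hyZ (h ▸ hxZ)
      rw [hf p hp, card_pair hxy]
  refine (card_le_card_of_injOn f hmaps hinj).trans ((card_union_le _ _).trans ?_)
  rw [card_powersetCard]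
  exact Nat.add_le_add_left
    (card_biUnion_le_card_mul _ _ _ fun x hx => card_image_le.trans (hW x hx)) _

theorem choose_two_add_le {t s z : ℕ} (hz : z ≤ t) :
    (t + s - z + 2).choose 2 + (z.choose 2 + z * (t + s - z)) ≤ (t + s + 2).choose 2 := by
  obtain ⟨b, rfl⟩ := Nat.exists_eq_add_of_le hz
  rw [show z + b + s - z = b + s by omega]
  have hz0 : (0 : ℚ) ≤ z := Nat.cast_nonneg z
  rw [← Nat.cast_le (α := ℚ)]
  push_cast [Nat.cast_choose_two]
  nlinarith

namespace CriticalSystem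

/-- A bound on the order of `H` in terms of the parameters `s` and `k`, which are free. -/
theorem card_vertices_le (C : CriticalSystem H t T) {X₀ : Finset α} {k : ℕ}
    (hX₀ : IsTransversal H X₀) (hX₀t : #X₀ = t) (hs : 0 < s) (hk : 0 < k) :
    ∃ r r' : ℕ, r * s ≤ t ∧ r' * k ≤ (t + s + 2).choose 2 + r' * s ∧
      #(H.biUnion id) ≤
        t + r * (t + 2) + r' * (s + 3) + t * (k + 2) + (t + s + 2).choose 2 := by
  obtain ⟨X, r, hX, hXcard, hr, hZ⟩ := C.exists_core X₀ hX₀t.le hs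
  set Z := doubleCentre H X₀ X with hZdef
  have hZX₀ : Z ⊆ X₀ := filter_subset _ _
  have hZX : Z ⊆ X := hZX₀.trans hX
  have hzt : #Z ≤ t := hX₀t ▸ card_le_card hZX₀
  obtain ⟨S, M, f, r', hf, hSP, hMP, hPcard, hr', hTS⟩ :=
    C.exists_isPartialMatching (P := H.biUnion id \ X) hX₀ hX hZ sdiff_disjoint hk
  have hSX : Disjoint S X := sdiff_disjoint.mono_left hSP
  have hMX : Disjoint M X := sdiff_disjoint.mono_left hMP
  have hedge : ∀ x ∈ Z, ∃ h ∈ H, x ∈ h := fun x hx => by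
    obtain ⟨-, h, hh, hxh, -⟩ := mem_filter.1 hx
    exact ⟨h, hh, hxh⟩
  choose! E hEH hE using hedge
  set D := Z.biUnion fun x => (T (E x) ∩ S) ∪ ((E x).erase x) with hD
  have hDcard : #D ≤ t * (k + 2) := by
    refine (card_biUnion_le_card_mul _ _ (k + 2) fun x hx => ?_).trans
      (Nat.mul_le_mul_right _ hzt)
    have h1 := card_union_le (T (E x) ∩ S) ((E x).erase x)
    have h2 := hTS _ (hEH x hx)
    rw [card_erase_of_mem (hE x hx), C.card_edge _ (hEH x hx)] at h1
    omega
  have hxT : ∀ x ∈ Z, x ∉ T (E x) := fun x hx =>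
    disjoint_left.1 (C.disjoint _ (hEH x hx)) (hE x hx)
  have havoid : ∀ x ∈ Z, ∀ p ∈ S \ D, p ∉ T (E x) ∧ p ∉ E x := by
    intro x hx p hp
    rw [mem_sdiff] at hp
    refine ⟨fun h => hp.2 (mem_biUnion.2 ⟨x, hx, mem_union_left _ (mem_inter.2 ⟨h, hp.1⟩)⟩),
      fun h => hp.2 (mem_biUnion.2 ⟨x, hx, mem_union_right _ (mem_erase.2 ⟨?_, h⟩)⟩)⟩
    rintro rfl
    exact disjoint_left.1 hSX hp.1 (hZX hx)
  have hSD : ∀ h ∈ H, #(h ∩ (S \ D)) ≤ 1 := by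
    intro h hh
    refine card_le_one.2 fun p hp q hq => ?_
    by_contra hpq
    rw [mem_inter] at hp hq
    have hpX := disjoint_left.1 hSX (mem_sdiff.1 hp.2).1
    have hqX := disjoint_left.1 hSX (mem_sdiff.1 hq.2).1
    obtain ⟨x, hx⟩ := hX₀ h hh
    rw [mem_inter] at hx
    have hxZ : x ∈ Z := mem_filter.2 ⟨hx.2, h, hh, hx.1, one_lt_card.2
      ⟨p, mem_sdiff.2 ⟨hp.1, hpX⟩, q, mem_sdiff.2 ⟨hq.1, hqX⟩, hpq⟩⟩
    have hxp : x ≠ p := fun h' => hpX (hX (h' ▸ hx.2))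
    have hxq : x ≠ q := fun h' => hqX (hX (h' ▸ hx.2))
    have hh3 : {x, p, q} = h := by
      refine eq_of_subset_of_card_le ?_ ?_
      · simp [insert_subset_iff, hx.1, hp.1, hq.1]
      · rw [C.card_edge h hh, card_eq_three.2 ⟨x, p, q, hxp, hxq, hpq, rfl⟩]
    obtain ⟨y, hy⟩ := C.meets _ (hEH x hxZ) h hh fun h' => (havoid x hxZ p hp.2).2 (h' ▸ hp.1)
    rw [mem_inter, ← hh3] at hy
    simp only [mem_insert, mem_singleton] at hy
    rcases hy with ⟨rfl | rfl | rfl, hyT⟩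
    · exact hxT _ hxZ hyT
    · exact (havoid x hxZ _ hp.2).1 hyT
    · exact (havoid x hxZ _ hq.2).1 hyT
  obtain ⟨g, hginj, hg⟩ := C.exists_injOn_hyperlink (S \ D) hSD fun p hp => by
    simpa using (mem_sdiff.1 (hSP (mem_sdiff.1 hp).1)).1
  set S₁ := (S \ D).filter fun p => Disjoint (g p) Z with hS₁
  set S₂ := (S \ D).filter fun p => ¬Disjoint (g p) Z with hS₂
  have hS₁S : S₁ ⊆ S := (filter_subset _ _).trans sdiff_subset
  have hMS₁ : Disjoint S₁ M := hf.disjoint.mono_left hS₁S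
  obtain ⟨F, hfeq, hgeq⟩ : ∃ F : α → Finset α, (∀ m ∈ M, F m = f m) ∧ ∀ m ∈ S₁, F m = g m :=
    ⟨fun p => if p ∈ M then f p else g p, fun m hm => if_pos hm,
      fun m hm => if_neg (disjoint_left.1 hMS₁ hm)⟩
  have hgS₁ : ∀ p ∈ S₁, g p ∈ hyperlink H p := fun p hp => hg p (mem_filter.1 hp).1
  have hcross : ∀ m ∈ M, ∀ p ∈ S₁, f m ≠ g p := fun m hm p hp h =>
    hf.notMem_link p (hS₁S hp) m hm (h ▸ hgS₁ p hp)
  have hfirst : #(M ∪ S₁) ≤ (t + s - #Z + 2).choose 2 := by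
    refine C.card_le_choose_of_injOn (Y := X \ Z) (f := F) ?_ ?_ ?_ ?_ ?_ sdiff_disjoint hZ
    · intro m hm
      rcases mem_union.1 hm with hm | hm
      · rw [hfeq m hm]
        exact hf.mem_link m hm
      · rw [hgeq m hm]
        exact hgS₁ m hm
    · intro m hm
      rcases mem_union.1 hm with hm | hm
      · rw [hfeq m hm]
        exact hf.subset m hm
      · rw [hgeq m hm]
        obtain ⟨hmg, hins⟩ := mem_hyperlink.1 (hgS₁ m hm)
        have := erase_subset_of_disjoint_doubleCentre (p := m) hX₀ hX hins (mem_insert_self _ _)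
          (disjoint_left.1 hSX (hS₁S hm))
        rw [erase_insert hmg] at this
        exact this (mem_filter.1 hm).2
    · intro a ha b hb hab
      rw [mem_coe, mem_union] at ha hb
      rcases ha with ha | ha <;> rcases hb with hb | hb
      · rw [hfeq a ha, hfeq b hb] at hab
        exact hf.injOn ha hb hab
      · rw [hfeq a ha, hgeq b hb] at hab
        exact absurd hab (hcross a ha b hb)
      · rw [hgeq a ha, hfeq b hb] at hab
        exact absurd hab.symm (hcross b hb a ha)
      · rw [hgeq a ha, hgeq b hb] at hab
        exact hginj (mem_filter.1 ha).1 (mem_filter.1 hb).1 hab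
    · exact (disjoint_union_left.2 ⟨hMX, hSX.mono_left hS₁S⟩).mono_right sdiff_subset
    · exact (disjoint_union_left.2 ⟨hMX, hSX.mono_left hS₁S⟩).mono_right hZX
  have hsecond : #S₂ ≤ (#Z).choose 2 + #Z * (t + s - #Z) := by
    refine card_le_of_injOn_pairs_meeting (f := g) (W := fun x => T (E x) \ Z)
      (fun p hp => C.card_of_mem_hyperlink (hg p (mem_filter.1 hp).1))
      (hginj.mono fun p hp => (mem_filter.1 hp).1) (fun p hp => (mem_filter.1 hp).2) ?_ ?_
    · intro x hx
      have h1 := C.card_lt _ (hEH x hx)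
      have h2 := hZ _ (hEH x hx)
      have h3 := card_sdiff_add_card_inter (T (E x)) Z
      have h4 := card_sdiff_add_card_inter Z (T (E x))
      rw [inter_comm] at h4
      omega
    · intro p hp x hx hxZ y hy hyZ
      have hpD := (mem_filter.1 hp).1
      have hlink := hg p hpD
      have hpair : {x, y} = g p := by
        refine eq_of_subset_of_card_le (insert_subset hx (singleton_subset_iff.2 hy)) ?_
        have hxy : x ≠ y := fun h => hyZ (h ▸ hxZ)
        rw [C.card_of_mem_hyperlink hlink, card_pair hxy]
      obtain ⟨z, hz⟩ := C.meets _ (hEH x hxZ) _ (mem_hyperlink.1 hlink).2 fun h' =>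
        (havoid x hxZ p hpD).2 (h' ▸ mem_insert_self _ _)
      rw [mem_inter, ← hpair] at hz
      simp only [mem_insert, mem_singleton] at hz
      rcases hz with ⟨rfl | rfl | rfl, hzT⟩
      · exact absurd hzT (havoid x hxZ _ hpD).1
      · exact absurd hzT (hxT _ hxZ)
      · exact mem_sdiff.2 ⟨hzT, hyZ⟩
  have hbound := choose_two_add_le (s := s) hzt
  have h1 : #(S \ D) = #S₁ + #S₂ := (card_filter_add_card_filter_not _).symm
  have h2 := card_union_of_disjoint hMS₁.symm
  have h3 := card_sdiff_add_card_inter S D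
  have h4 := card_le_card (inter_subset_right : S ∩ D ⊆ D)
  have h5 := card_sdiff_add_card_inter (H.biUnion id) X
  have h6 := card_le_card (inter_subset_right : H.biUnion id ∩ X ⊆ X)
  exact ⟨r, r', hr, by omega, by omega⟩

end CriticalSystem

end CriticalSystem

/-- A `3`-uniform `τ`-critical hypergraph is a `CriticalSystem`, and it has a transversal of
minimum size. -/
theorem exists_criticalSystem {α : Type} [DecidableEq α] {H : Finset (Finset α)}
    (hunif : ∀ e ∈ H, e.card = 3)
    (hcrit : ∀ e ∈ H, transversalNumber (H.erase e) < transversalNumber H) :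
    ∃ T X₀, CriticalSystem H (transversalNumber H) T ∧ IsTransversal H X₀ ∧
      X₀.card = transversalNumber H := by
  have hle : ∀ S, IsTransversal H S → transversalNumber H ≤ S.card := fun S hS =>
    Nat.sInf_le ⟨S, hS, rfl⟩
  have hV : ∀ H' ⊆ H, ∃ S, IsTransversal H' S ∧ S.card = transversalNumber H' := by
    intro H' hH'
    refine Nat.sInf_mem (s := {c | ∃ S, IsTransversal H' S ∧ S.card = c})
      ⟨_, H'.biUnion id, fun e he => ?_, rfl⟩
    rw [Finset.inter_eq_left.2
      (show e ⊆ H'.biUnion id from Finset.subset_biUnion_of_mem id he)]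
    exact Finset.card_pos.1 (by rw [hunif e (hH' he)]; norm_num)
  obtain ⟨X₀, hX₀, hX₀c⟩ := hV H subset_rfl
  choose! T hT hTc using fun e (_ : e ∈ H) => hV (H.erase e) (Finset.erase_subset e H)
  refine ⟨T, X₀, ⟨hunif, hle, fun e he => hTc e he ▸ hcrit e he, fun e he => ?_,
    fun e he h hh hne => hT e he h (Finset.mem_erase.2 ⟨hne, hh⟩)⟩, hX₀, hX₀c⟩
  by_contra hd
  refine (hTc e he ▸ hcrit e he).not_ge (hle (T e) fun h hh => ?_)
  by_cases hne : h = e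
  · subst hne
    rwa [Finset.not_disjoint_iff_nonempty_inter] at hd
  · exact hT e he h (Finset.mem_erase.2 ⟨hne, hh⟩)

/-- The numerical estimate behind the choice `s ≈ t ^ (1 / 3)`. -/
theorem bound_of_scale {t s r r' v c u : ℝ} (hu : 1 ≤ u) (ht : t = u ^ 3) (hus : u ≤ s)
    (hsu : s ≤ 2 * u) (hr : r * s ≤ t) (hr' : r' * (2 * s ^ 2) ≤ c + r' * s)
    (hr0 : 0 ≤ r) (hr'0 : 0 ≤ r') (hc : c = (t + s + 2) * (t + s + 1) / 2)
    (hv : v ≤ t + r * (t + 2) + r' * (s + 3) + t * (2 * s ^ 2 + 2) + c) :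
    v ≤ (t + 2) * (t + 1) / 2 + 100 * u ^ 5 := by
  have hu0 : 0 < u := by linarith
  have hs0 : 0 < s := hu0.trans_le hus
  have h2 : 1 ≤ u ^ 2 := one_le_pow₀ hu
  have h3 : u ≤ u ^ 3 := le_self_pow₀ hu (by norm_num)
  have h4 : u ^ 4 ≤ u ^ 5 := pow_le_pow_right₀ hu (by norm_num)
  have h5 : u ^ 3 ≤ u ^ 5 := pow_le_pow_right₀ hu (by norm_num)
  have h6 : u ^ 2 ≤ u ^ 5 := pow_le_pow_right₀ hu (by norm_num)
  have h7 : u ≤ u ^ 5 := le_self_pow₀ hu (by norm_num)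
  have hru : r ≤ u ^ 2 := by
    refine le_of_mul_le_mul_right ?_ hu0
    calc r * u ≤ r * s := by gcongr
      _ ≤ u ^ 2 * u := by rw [← pow_succ, ← ht]; exact hr
  have hr1 : r * (t + 2) ≤ 3 * u ^ 5 := by
    calc r * (t + 2) ≤ u ^ 2 * (u ^ 3 + 2) := by rw [ht]; gcongr
      _ ≤ 3 * u ^ 5 := by nlinarith
  have hc6 : c ≤ 15 * u ^ 6 := by
    have h8 : t + s + 2 ≤ 5 * u ^ 3 := by linarith
    have h9 : t + s + 1 ≤ 5 * u ^ 3 := by linarith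
    have h10 : 0 ≤ t + s + 1 := by rw [ht]; positivity
    rw [hc]
    calc (t + s + 2) * (t + s + 1) / 2 ≤ (5 * u ^ 3) * (5 * u ^ 3) / 2 := by gcongr
      _ ≤ 15 * u ^ 6 := by nlinarith [pow_pos hu0 6]
  have hr2 : r' * s ≤ 15 * u ^ 5 := by
    refine le_of_mul_le_mul_right ?_ hu0
    have h8 : r' * s ≤ r' * s ^ 2 := by
      gcongr
      nlinarith
    calc r' * s * u ≤ r' * s * s := by gcongr
      _ ≤ c := by nlinarith
      _ ≤ 15 * u ^ 5 * u := by linarith [pow_succ u 5]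
  have hr3 : r' ≤ r' * s := le_mul_of_one_le_right hr'0 (hu.trans hus)
  have hs2 : s ^ 2 ≤ 4 * u ^ 2 := by nlinarith
  have ht1 : t * (2 * s ^ 2 + 2) ≤ 10 * u ^ 5 := by
    calc t * (2 * s ^ 2 + 2) ≤ u ^ 3 * (2 * (4 * u ^ 2) + 2 * u ^ 2) := by
          rw [ht]; gcongr; linarith
      _ = 10 * u ^ 5 := by ring
  have hst : s * t ≤ 2 * u ^ 5 := by
    calc s * t ≤ 2 * u * u ^ 3 := by rw [ht]; gcongr
      _ = 2 * u ^ 4 := by ring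
      _ ≤ 2 * u ^ 5 := by gcongr
  rw [hc] at hv
  nlinarith

/-- there is a constant `C > 0` such that every `3`-uniform `τ`-critical
hypergraph `H` with transversal number `t` satisfies `|V(H)| ≤ C(t+2,2) + C·t^{5/3}`. -/
theorem tau_critical_order_bound :
    ∃ C : ℝ, 0 < C ∧
      ∀ (α : Type) [DecidableEq α] (H : Finset (Finset α)),
        (∀ e ∈ H, e.card = 3) →
        (∀ e ∈ H, transversalNumber (H.erase e) < transversalNumber H) →
        ((H.biUnion id).card : ℝ) ≤
          (Nat.choose (transversalNumber H + 2) 2 : ℝ)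
            + C * (transversalNumber H : ℝ) ^ ((5 : ℝ) / 3) := by
  refine ⟨100, by norm_num, fun α _ H hunif hcrit => ?_⟩
  rcases H.eq_empty_or_nonempty with rfl | hH
  · simp only [Finset.biUnion_empty, Finset.card_empty, Nat.cast_zero]
    positivity
  obtain ⟨T, X₀, C, hX₀, hX₀t⟩ := exists_criticalSystem hunif hcrit
  obtain ⟨e, he⟩ := hH
  set t := transversalNumber H
  have ht : 1 ≤ t := by have := C.card_lt e he; omega
  set u : ℝ := (t : ℝ) ^ ((1 : ℝ) / 3) with hu
  have hu1 : 1 ≤ u := Real.one_le_rpow (by exact_mod_cast ht) (by norm_num)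
  have hu3 : (t : ℝ) = u ^ 3 := by
    rw [hu, ← Real.rpow_mul_natCast t.cast_nonneg]
    norm_num
  have hu5 : (t : ℝ) ^ ((5 : ℝ) / 3) = u ^ 5 := by
    rw [hu, ← Real.rpow_mul_natCast t.cast_nonneg]
    norm_num
  have hs : 0 < ⌈u⌉₊ := Nat.ceil_pos.2 (by linarith)
  obtain ⟨r, r', hr, hr', hcard⟩ :=
    C.card_vertices_le (k := 2 * ⌈u⌉₊ ^ 2) hX₀ hX₀t hs (by positivity)
  rw [hu5]
  have hsu := Nat.ceil_lt_add_one (zero_le_one.trans hu1)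
  have := bound_of_scale (v := (H.biUnion id).card) (r := r) (r' := r')
    (c := ((t + ⌈u⌉₊ + 2).choose 2 : ℕ)) hu1 hu3
    (Nat.le_ceil u) (by linarith) (by exact_mod_cast hr) (by exact_mod_cast hr')
    r.cast_nonneg r'.cast_nonneg (by rw [Nat.cast_choose_two]; push_cast; ring)
    (by exact_mod_cast hcard)
  refine this.trans_eq ?_
  rw [Nat.cast_choose_two]
  push_cast
  ring
end

section
/- Given an (n,m)-system with decomposition data, assume m ≥ 1, t < m, and |G| ≤ 3m. Then the number of index pairs (x, y) such that N_x is heavy (i.e., |Γ_x| ≥ m^{1/3}) and 0 ≤ y ≤ t_x − 1 is at most 3·m^{5/3} (as a real inequality). -/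
open Finset

/-- Decomposition data for an `(n,m)`-system: stage numbers `t i` (weakly decreasing in `i`)
with at least `4` surviving sets at each stage `j ≤ t = t 0`, together with pairwise
distinct kernel vertices `a i s` (for `s ≤ t i`) satisfying `a i s ∉ N i` and
`a i s ∈ N r` for every `r ≠ i` with `s ≤ t r`. -/
structure Decomp {α : Type*} [DecidableEq α] (S : NMSystem α) where
  t : Fin S.ell → ℕ
  a : Fin S.ell → ℕ → α
  h_mono : ∀ i j : Fin S.ell, i ≤ j → t j ≤ t i
  h_stages : ∀ j : ℕ, j ≤ t ⟨0, Nat.lt_of_lt_of_le Nat.zero_lt_two S.h_ell⟩ →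
      4 ≤ (Finset.univ.filter (fun i => j ≤ t i)).card
  h_a_mem : ∀ i s, s ≤ t i → a i s ∈ S.V
  h_a_not : ∀ i s, s ≤ t i → a i s ∉ S.N i
  h_a_in : ∀ i s, s ≤ t i → ∀ r, r ≠ i → s ≤ t r → a i s ∈ S.N r
  h_a_inj : ∀ i s i' s', s ≤ t i → s' ≤ t i' → (i ≠ i' ∨ s ≠ s') → a i s ≠ a i' s'

namespace Decomp

variable {α : Type*} [DecidableEq α] {S : NMSystem α} (D : Decomp S)

/-- the total number of stages `t = t_1` -/
def T : ℕ := D.t ⟨0, Nat.lt_of_lt_of_le Nat.zero_lt_two S.h_ell⟩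

/-- the set `A` of all kernel vertices -/
def A : Finset α :=
  Finset.univ.biUnion (fun i => (Finset.range (D.t i + 1)).image (D.a i))

/-- the set `G = V \ A` of garbage vertices -/
def G : Finset α := S.V \ D.A

/-- the critical time `t_g` of a vertex `g` -/
def tg (g : α) : ℕ := (Finset.univ.filter (fun i => g ∈ S.N i)).sup D.t

/-- the critical index set `I_g` of a vertex `g` -/
def Ig (g : α) : Finset (Fin S.ell) :=
  Finset.univ.filter (fun i => g ∈ S.N i ∧ D.t i = D.tg g)

/-- the set `Γ_x` of critical garbage vertices of `N x` -/
def Gamma (x : Fin S.ell) : Finset α := D.G.filter (fun g => D.Ig g = {x})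

/-- `v` is a private vertex for `N i` at time `j` -/
def IsPrivateVertex (i : Fin S.ell) (j : ℕ) (v : α) : Prop :=
  v ∈ S.N i ∧ ∀ r, r ≠ i → j ≤ D.t r → v ∉ S.N r

/-- `p` is a private pair for `N i` at time `j` -/
def IsPrivatePair (i : Fin S.ell) (j : ℕ) (p : Finset α) : Prop :=
  p ⊆ S.N i ∧ p.card = 2 ∧ ∀ r, r ≠ i → j ≤ D.t r → ¬ p ⊆ S.N r

/-- `C` is a `3`-cross of `N i` at time `j` with respect to `Y` -/
def IsThreeCross (i : Fin S.ell) (j : ℕ) (Y C : Finset α) : Prop :=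
  C.card = 3 ∧ C ⊆ (S.N i ∪ (Finset.range (j + 1)).image (D.a i)) \ Y ∧
    ∀ r, ¬ C ⊆ S.N r

end Decomp

namespace Decomp

variable {α : Type*} [DecidableEq α] {S : NMSystem α}

lemma t_le_T (D : Decomp S) (x : Fin S.ell) : D.t x ≤ D.T :=
  D.h_mono _ _ (Fin.mk_le_of_le_val (Nat.zero_le _))

lemma pairwiseDisjoint_Gamma (D : Decomp S) (s : Set (Fin S.ell)) :
    s.PairwiseDisjoint D.Gamma := by
  intro x _ y _ hxy
  refine Finset.disjoint_left.2 fun g hx hy => hxy ?_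
  simp only [Gamma, Finset.mem_filter] at hx hy
  exact Finset.singleton_injective (hx.2.symm.trans hy.2)

lemma sum_card_Gamma_le (D : Decomp S) : ∑ x, (D.Gamma x).card ≤ D.G.card := by
  rw [← Finset.card_biUnion fun x _ y _ hxy =>
    D.pairwiseDisjoint_Gamma Set.univ (Set.mem_univ x) (Set.mem_univ y) hxy]
  exact Finset.card_le_card (Finset.biUnion_subset.2 fun x _ => Finset.filter_subset _ _)

lemma sum_sigma_card_Gamma_le (D : Decomp S) :
    ∑ q ∈ (Finset.univ : Finset (Fin S.ell)).sigma (fun x => Finset.range (D.t x)),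
      (D.Gamma q.1).card ≤ D.T * D.G.card := by
  rw [Finset.sum_sigma]
  simp only [Finset.sum_const, Finset.card_range, smul_eq_mul]
  calc ∑ x, D.t x * (D.Gamma x).card
      ≤ ∑ x, D.T * (D.Gamma x).card :=
        Finset.sum_le_sum fun x _ => Nat.mul_le_mul_right _ (D.t_le_T x)
    _ = D.T * ∑ x, (D.Gamma x).card := (Finset.mul_sum ..).symm
    _ ≤ D.T * D.G.card := Nat.mul_le_mul_left _ D.sum_card_Gamma_le

end Decomp

open scoped Classical in
/-- if `m ≥ 1`, `t < m` and `|G| ≤ 3m`, then the number of index pairs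
`(x, y)` with `N x` heavy (`|Γ_x| ≥ m^{1/3}`) and `0 ≤ y ≤ t x - 1` is at most
`3·m^{5/3}`. -/
theorem heavy_head_pairs_bound {α : Type*} [DecidableEq α]
    (S : NMSystem α) (D : Decomp S)
    (hm : 1 ≤ S.m) (ht : D.T < S.m) (hG : D.G.card ≤ 3 * S.m) :
    ((((Finset.univ : Finset (Fin S.ell)).sigma fun x => Finset.range (D.t x)).filter
        (fun q => (S.m : ℝ) ^ ((1 : ℝ) / 3) ≤ ((D.Gamma q.1).card : ℝ))).card : ℝ)
      ≤ 3 * (S.m : ℝ) ^ ((5 : ℝ) / 3) := by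
  have hm0 : (0 : ℝ) < S.m := by exact_mod_cast hm
  set P := ((Finset.univ : Finset (Fin S.ell)).sigma fun x => Finset.range (D.t x)).filter
    (fun q => (S.m : ℝ) ^ ((1 : ℝ) / 3) ≤ ((D.Gamma q.1).card : ℝ))
  have lower : (P.card : ℝ) * (S.m : ℝ) ^ ((1 : ℝ) / 3) ≤
      ((∑ q ∈ P, (D.Gamma q.1).card : ℕ) : ℝ) := by
    rw [← nsmul_eq_mul, Nat.cast_sum]
    exact Finset.card_nsmul_le_sum _ _ _ fun q hq => (Finset.mem_filter.1 hq).2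
  have upper : ∑ q ∈ P, (D.Gamma q.1).card ≤ S.m * (3 * S.m) :=
    (Finset.sum_le_sum_of_subset (Finset.filter_subset _ _)).trans
      (D.sum_sigma_card_Gamma_le.trans (Nat.mul_le_mul ht.le hG))
  have upper' : ((∑ q ∈ P, (D.Gamma q.1).card : ℕ) : ℝ) ≤ (S.m : ℝ) * (3 * S.m) := by
    exact_mod_cast upper
  have split : (S.m : ℝ) ^ ((5 : ℝ) / 3) * (S.m : ℝ) ^ ((1 : ℝ) / 3) = (S.m : ℝ) ^ 2 := by
    rw [← Real.rpow_add hm0, ← Real.rpow_natCast]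
    norm_num
  refine le_of_mul_le_mul_right ?_ (Real.rpow_pos_of_pos hm0 ((1 : ℝ) / 3))
  rw [mul_assoc, split]
  linarith
end
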